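/- For every δ ∈ (0,1) there is a constant C = C(M, δ) > 0 such that: for every spherically symmetric solution φ of the wave equation on the exterior of the Schwarzschild spacetime of mass M with E₁(φ) < ∞, setting ψ := Sφ = t ∂_tφ + s ∂_sφ, for all t* ≥ 1 one has ∫_ℝ [ ((t*−s)/2)² (∂_tψ − ∂_sψ)² + ((t*+s)/2)² (∂_tψ + ∂_sψ)² + (1−μ(s)) ((t*² + s²)/r(s)²) ψ² ](t*, s) · r(s)² ds ≤ C t*^{δ} E₁(φ). -/

import Mathlib

open Real MeasureTheory

noncomputable section

/-- partial derivative in the first (time) variable -/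
def pd_t (φ : ℝ → ℝ → ℝ) : ℝ → ℝ → ℝ := fun t s => deriv (fun t' => φ t' s) t

/-- partial derivative in the second (tortoise) variable -/
def pd_s (φ : ℝ → ℝ → ℝ) : ℝ → ℝ → ℝ := fun t s => deriv (fun s' => φ t s') s

/-- the scaling vector field `S ξ = t ∂_t ξ + s ∂_s ξ` -/
def Svf (φ : ℝ → ℝ → ℝ) : ℝ → ℝ → ℝ := fun t s => t * pd_t φ t s + s * pd_s φ t s

/-- `r` is the Schwarzschild area-radius of mass `M` in the Regge-Wheeler tortoise
coordinate: `r(s) > 2M`, `r' = 1 - 2M/r`, `r(0) = 3M`. -/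
def IsTortoise (M : ℝ) (r : ℝ → ℝ) : Prop :=
  (∀ s, 2 * M < r s) ∧ (∀ s, HasDerivAt r (1 - 2 * M / r s) s) ∧ r 0 = 3 * M

/-- `μ(s) = 2M / r(s)` -/
def muS (M : ℝ) (r : ℝ → ℝ) (s : ℝ) : ℝ := 2 * M / r s

/-- a spherically symmetric solution of the wave equation on the exterior of the
Schwarzschild spacetime: smooth, satisfying `∂_t²φ = r⁻² ∂_s(r² ∂_s φ)`, and supported
away from spatial infinity. -/
def IsWaveSol (r : ℝ → ℝ) (φ : ℝ → ℝ → ℝ) : Prop :=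
  ContDiff ℝ (⊤ : ℕ∞) (Function.uncurry φ) ∧
  (∀ t s, pd_t (pd_t φ) t s = ((r s) ^ 2)⁻¹ * deriv (fun x => (r x) ^ 2 * pd_s φ t x) s) ∧
  ∃ S₀ : ℝ, ∀ t s, S₀ + |t - 1| ≤ s → φ t s = 0

/-- the integrand of the initial energy `E₀(ξ)`, evaluated on the slice `t = 1`. -/
def E0Integrand (M : ℝ) (r : ℝ → ℝ) (ξ : ℝ → ℝ → ℝ) (s : ℝ) : ℝ :=
  ((1 - muS M r s)⁻¹ * (pd_t ξ 1 s - pd_s ξ 1 s) ^ 2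
    + (pd_t ξ 1 s + pd_s ξ 1 s) ^ 2
    + ((1 - s) / 2) ^ 2 * (pd_t ξ 1 s - pd_s ξ 1 s) ^ 2
    + ((1 + s) / 2) ^ 2 * (pd_t ξ 1 s + pd_s ξ 1 s) ^ 2
    + (1 - muS M r s) * ((1 + s ^ 2) / (r s) ^ 2) * (ξ 1 s) ^ 2) * (r s) ^ 2

/-- the initial energy `E₀(ξ)` -/
def E0 (M : ℝ) (r : ℝ → ℝ) (ξ : ℝ → ℝ → ℝ) : ℝ := ∫ s, E0Integrand M r ξ s

/-- `E₀(ξ) < ∞` : the (nonnegative) integrand of `E₀(ξ)` is integrable -/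
def FinE0 (M : ℝ) (r : ℝ → ℝ) (ξ : ℝ → ℝ → ℝ) : Prop := Integrable (E0Integrand M r ξ)

/-- `E₁(ξ) = E₀(Sξ) + E₀(ξ) + E₀(∂_t ξ)` -/
def E1 (M : ℝ) (r : ℝ → ℝ) (ξ : ℝ → ℝ → ℝ) : ℝ :=
  E0 M r (Svf ξ) + E0 M r ξ + E0 M r (pd_t ξ)

/-- `E₁(ξ) < ∞` -/
def FinE1 (M : ℝ) (r : ℝ → ℝ) (ξ : ℝ → ℝ → ℝ) : Prop :=
  FinE0 M r (Svf ξ) ∧ FinE0 M r ξ ∧ FinE0 M r (pd_t ξ)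

/-- smooth functions of two variables -/
def Sm (ξ : ℝ → ℝ → ℝ) : Prop := ContDiff ℝ (⊤ : ℕ∞) (Function.uncurry ξ)

theorem hasT_of_diff {ξ : ℝ → ℝ → ℝ} {t s : ℝ}
    (h : DifferentiableAt ℝ (Function.uncurry ξ) (t, s)) :
    HasDerivAt (fun t' => ξ t' s) (fderiv ℝ (Function.uncurry ξ) (t, s) (1, 0)) t := by
  have h1 : HasDerivAt (fun t' : ℝ => (t', s)) ((1 : ℝ), (0 : ℝ)) t :=
    (hasDerivAt_id t).prodMk (hasDerivAt_const t s)
  exact h.hasFDerivAt.comp_hasDerivAt (f := fun t' : ℝ => (t', s)) t h1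

theorem hasS_of_diff {ξ : ℝ → ℝ → ℝ} {t s : ℝ}
    (h : DifferentiableAt ℝ (Function.uncurry ξ) (t, s)) :
    HasDerivAt (fun s' => ξ t s') (fderiv ℝ (Function.uncurry ξ) (t, s) (0, 1)) s := by
  have h1 : HasDerivAt (fun s' : ℝ => (t, s')) ((0 : ℝ), (1 : ℝ)) s :=
    (hasDerivAt_const s t).prodMk (hasDerivAt_id s)
  exact h.hasFDerivAt.comp_hasDerivAt (f := fun s' : ℝ => (t, s')) s h1

theorem hasD_of_diff {ξ : ℝ → ℝ → ℝ} {t y : ℝ}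
    (h : DifferentiableAt ℝ (Function.uncurry ξ) (t, y + t)) :
    HasDerivAt (fun t' => ξ t' (y + t')) (fderiv ℝ (Function.uncurry ξ) (t, y + t) (1, 1)) t := by
  have h1 : HasDerivAt (fun t' : ℝ => (t', y + t')) ((1 : ℝ), (1 : ℝ)) t :=
    (hasDerivAt_id t).prodMk ((hasDerivAt_id t).const_add y)
  exact h.hasFDerivAt.comp_hasDerivAt (f := fun t' : ℝ => (t', y + t')) t h1

theorem Sm.diff {ξ : ℝ → ℝ → ℝ} (h : Sm ξ) (p : ℝ × ℝ) :
    DifferentiableAt ℝ (Function.uncurry ξ) p :=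
  (ContDiff.differentiable h (by simp)) p

theorem Sm.pd_t_eq {ξ : ℝ → ℝ → ℝ} (h : Sm ξ) (t s : ℝ) :
    pd_t ξ t s = fderiv ℝ (Function.uncurry ξ) (t, s) (1, 0) :=
  (hasT_of_diff (h.diff (t, s))).deriv

theorem Sm.pd_s_eq {ξ : ℝ → ℝ → ℝ} (h : Sm ξ) (t s : ℝ) :
    pd_s ξ t s = fderiv ℝ (Function.uncurry ξ) (t, s) (0, 1) :=
  (hasS_of_diff (h.diff (t, s))).deriv

theorem Sm.hasT {ξ : ℝ → ℝ → ℝ} (h : Sm ξ) (t s : ℝ) :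
    HasDerivAt (fun t' => ξ t' s) (pd_t ξ t s) t := by
  rw [h.pd_t_eq]; exact hasT_of_diff (h.diff (t, s))

theorem Sm.hasS {ξ : ℝ → ℝ → ℝ} (h : Sm ξ) (t s : ℝ) :
    HasDerivAt (fun s' => ξ t s') (pd_s ξ t s) s := by
  rw [h.pd_s_eq]; exact hasS_of_diff (h.diff (t, s))

theorem Sm.fd {ξ : ℝ → ℝ → ℝ} (h : Sm ξ) (w : ℝ × ℝ) :
    ContDiff ℝ (⊤ : ℕ∞) (fun p => fderiv ℝ (Function.uncurry ξ) p w) := by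
  have h1 : ContDiff ℝ (⊤ : ℕ∞) (fderiv ℝ (Function.uncurry ξ)) :=
    ContDiff.fderiv_right h (by simp)
  exact h1.clm_apply contDiff_const

theorem Sm.pdt {ξ : ℝ → ℝ → ℝ} (h : Sm ξ) : Sm (pd_t ξ) := by
  have : Function.uncurry (pd_t ξ) = fun p => fderiv ℝ (Function.uncurry ξ) p (1, 0) := by
    ext ⟨t, s⟩; exact h.pd_t_eq t s
  rw [Sm, this]; exact h.fd _

theorem Sm.pds {ξ : ℝ → ℝ → ℝ} (h : Sm ξ) : Sm (pd_s ξ) := by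
  have : Function.uncurry (pd_s ξ) = fun p => fderiv ℝ (Function.uncurry ξ) p (0, 1) := by
    ext ⟨t, s⟩; exact h.pd_s_eq t s
  rw [Sm, this]; exact h.fd _

theorem Sm.comm {ξ : ℝ → ℝ → ℝ} (h : Sm ξ) (t s : ℝ) :
    pd_t (pd_s ξ) t s = pd_s (pd_t ξ) t s := by
  have e1 : Function.uncurry (pd_t ξ) = fun p => fderiv ℝ (Function.uncurry ξ) p (1, 0) := by
    ext ⟨t, s⟩; exact h.pd_t_eq t s
  have e2 : Function.uncurry (pd_s ξ) = fun p => fderiv ℝ (Function.uncurry ξ) p (0, 1) := by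
    ext ⟨t, s⟩; exact h.pd_s_eq t s
  have h1 : ContDiff ℝ (⊤ : ℕ∞) (fderiv ℝ (Function.uncurry ξ)) :=
    ContDiff.fderiv_right h (by simp)
  have hd : DifferentiableAt ℝ (fderiv ℝ (Function.uncurry ξ)) (t, s) :=
    (h1.differentiable (by simp)) _
  rw [h.pds.pd_t_eq, h.pdt.pd_s_eq, e1, e2]
  rw [fderiv_clm_apply hd (by fun_prop), fderiv_clm_apply hd (by fun_prop)]
  have hs : IsSymmSndFDerivAt ℝ (Function.uncurry ξ) (t, s) :=
    (ContDiff.contDiffAt h).isSymmSndFDerivAt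
      (by simp only [minSmoothness_of_isRCLikeNormedField]; exact WithTop.coe_le_coe.2 le_top)
  simpa using hs (1, 0) (0, 1)

theorem energy_mono (P Q : ℝ → ℝ → ℝ)
    (hP : ∀ t s, 0 < t → ContDiffAt ℝ 1 (Function.uncurry P) (t, s))
    (hQ : ∀ t s, 0 < t → ContDiffAt ℝ 1 (Function.uncurry Q) (t, s))
    (hdiv : ∀ t s pt qs, 1 ≤ t → HasDerivAt (fun t' => P t' s) pt t →
      HasDerivAt (fun s' => Q t s') qs s → pt + qs ≤ 0)
    (hPQ : ∀ t s, 1 ≤ t → Q t s ≤ P t s)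
    (a b : ℝ) (hab : a ≤ b) (hb : ∀ t, 1 ≤ t → P t (b + t) = 0 ∧ Q t (b + t) = 0)
    (T : ℝ) (hT : 1 ≤ T) :
    ∫ y in a..b, P T (y + T) ≤ ∫ y in a..b, P 1 (y + 1) := by
  have hPd : ∀ t s, 0 < t → DifferentiableAt ℝ (Function.uncurry P) (t, s) :=
    fun t s ht => (hP t s ht).differentiableAt (by simp)
  have hQd : ∀ t s, 0 < t → DifferentiableAt ℝ (Function.uncurry Q) (t, s) :=
    fun t s ht => (hQ t s ht).differentiableAt (by simp)
  have hPc : ∀ w : ℝ × ℝ, ∀ t s, 0 < t →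
      ContinuousAt (fun p => fderiv ℝ (Function.uncurry P) p w) (t, s) := by
    intro w t s ht
    have : ContinuousAt (fderiv ℝ (Function.uncurry P)) (t, s) :=
      ((hP t s ht).fderiv_right (m := 0) (by simp)).continuousAt
    exact this.clm_apply continuousAt_const
  have hQc : ∀ w : ℝ × ℝ, ∀ t s, 0 < t →
      ContinuousAt (fun p => fderiv ℝ (Function.uncurry Q) p w) (t, s) := by
    intro w t s ht
    have : ContinuousAt (fderiv ℝ (Function.uncurry Q)) (t, s) :=
      ((hQ t s ht).fderiv_right (m := 0) (by simp)).continuousAt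
    exact this.clm_apply continuousAt_const
  -- continuity along slices
  have slice : ∀ (g : ℝ × ℝ → ℝ) (t : ℝ), (∀ s, ContinuousAt g (t, s)) →
      Continuous (fun y => g (t, y + t)) := by
    intro g t hg
    rw [continuous_iff_continuousAt]
    intro y
    exact ContinuousAt.comp (f := fun y : ℝ => (t, y + t)) (g := g) (hg (y + t)) (by fun_prop)
  have hder : ∀ t, 0 < t → HasDerivAt (fun t => ∫ y in a..b, P t (y + t))
      (∫ y in a..b, fderiv ℝ (Function.uncurry P) (t, y + t) (1, 1)) t := by
    intro t ht
    -- bound on compact set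
    have hK : IsCompact ((Set.Icc (t / 2) (t + 1)) ×ˢ (Set.Icc a b)) :=
      isCompact_Icc.prod isCompact_Icc
    have hcont : ContinuousOn (fun p : ℝ × ℝ =>
        fderiv ℝ (Function.uncurry P) (p.1, p.2 + p.1) (1, 1))
        ((Set.Icc (t / 2) (t + 1)) ×ˢ (Set.Icc a b)) := by
      intro p hp
      have hp1 : 0 < p.1 := by have := hp.1.1; linarith
      apply ContinuousAt.continuousWithinAt
      exact ContinuousAt.comp (f := fun p : ℝ × ℝ => (p.1, p.2 + p.1))
        (g := fun p => fderiv ℝ (Function.uncurry P) p (1, 1)) (hPc (1, 1) _ _ hp1) (by fun_prop)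
    obtain ⟨C, hC⟩ := hK.exists_bound_of_continuousOn hcont
    refine (intervalIntegral.hasDerivAt_integral_of_dominated_loc_of_deriv_le
      (F := fun t y => P t (y + t))
      (F' := fun t y => fderiv ℝ (Function.uncurry P) (t, y + t) (1, 1))
      (s := Set.Icc (t / 2) (t + 1)) (bound := fun _ => C) (Icc_mem_nhds (by linarith) (by linarith))
      ?_ ?_ ?_ ?_ ?_ ?_).2
    · filter_upwards [Icc_mem_nhds (a := t / 2) (b := t + 1) (x := t) (by linarith) (by linarith)]
        with x hx
      have hx0 : 0 < x := by have := hx.1; linarith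
      exact (slice (Function.uncurry P) x
        (fun s => (hPd x s hx0).continuousAt)).aestronglyMeasurable
    · exact (slice (Function.uncurry P) t
        (fun s => (hPd t s ht).continuousAt)).intervalIntegrable _ _
    · exact (slice (fun p => fderiv ℝ (Function.uncurry P) p (1, 1)) t
        (fun s => hPc (1, 1) t s ht)).aestronglyMeasurable
    · refine Filter.Eventually.of_forall fun y hy x hx => hC (x, y) ⟨hx, ?_⟩
      rw [Set.uIoc_of_le hab] at hy
      exact ⟨hy.1.le, hy.2⟩
    · exact intervalIntegrable_const
    · refine Filter.Eventually.of_forall fun y hy x hx => ?_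
      have hx0 : 0 < x := by have := hx.1; linarith
      exact hasD_of_diff (hPd x _ hx0)
  have hneg : ∀ t, 1 ≤ t →
      (∫ y in a..b, fderiv ℝ (Function.uncurry P) (t, y + t) (1, 1)) ≤ 0 := by
    intro t ht
    have ht0 : 0 < t := by linarith
    have hFTC : (∫ y in a..b, (fderiv ℝ (Function.uncurry P) (t, y + t) (0, 1)
        - fderiv ℝ (Function.uncurry Q) (t, y + t) (0, 1)))
        = (P t (b + t) - Q t (b + t)) - (P t (a + t) - Q t (a + t)) := by
      apply intervalIntegral.integral_eq_sub_of_hasDerivAt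
        (f := fun y => P t (y + t) - Q t (y + t))
      · intro y _
        exact ((hasS_of_diff (hPd t (y + t) ht0)).comp_add_const y t).sub
          ((hasS_of_diff (hQd t (y + t) ht0)).comp_add_const y t)
      · apply Continuous.intervalIntegrable
        exact (slice _ t (fun s => hPc (0, 1) t s ht0)).sub
          (slice _ t (fun s => hQc (0, 1) t s ht0))
    have hle : (∫ y in a..b, fderiv ℝ (Function.uncurry P) (t, y + t) (1, 1))
        ≤ ∫ y in a..b, (fderiv ℝ (Function.uncurry P) (t, y + t) (0, 1)
        - fderiv ℝ (Function.uncurry Q) (t, y + t) (0, 1)) := by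
      apply intervalIntegral.integral_mono_on hab
      · exact (slice _ t (fun s => hPc (1, 1) t s ht0)).intervalIntegrable _ _
      · apply Continuous.intervalIntegrable
        exact (slice _ t (fun s => hPc (0, 1) t s ht0)).sub
          (slice _ t (fun s => hQc (0, 1) t s ht0))
      · intro y _
        have h1 := hdiv t (y + t) _ _ ht (hasT_of_diff (hPd t (y + t) ht0))
          (hasS_of_diff (hQd t (y + t) ht0))
        have h2 : ((1 : ℝ), (1 : ℝ)) = (1, 0) + (0, 1) := by simp
        rw [h2, map_add]
        linarith
    rw [hFTC, (hb t ht).1, (hb t ht).2] at hle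
    have := hPQ t (a + t) ht
    linarith
  have hanti : AntitoneOn (fun t => ∫ y in a..b, P t (y + t)) (Set.Ici 1) := by
    apply antitoneOn_of_deriv_nonpos (convex_Ici 1)
    · intro t ht
      exact (hder t (lt_of_lt_of_le one_pos ht)).continuousAt.continuousWithinAt
    · intro t ht
      rw [interior_Ici] at ht
      exact (hder t (lt_trans one_pos ht)).differentiableAt.differentiableWithinAt
    · intro t ht
      rw [interior_Ici] at ht
      rw [(hder t (lt_trans one_pos ht)).deriv]
      exact hneg t (le_of_lt ht)
  exact hanti (Set.mem_Ici.2 le_rfl) (Set.mem_Ici.2 hT) hT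

/-- `√(1 - μ)` -/
def yS (M : ℝ) (r : ℝ → ℝ) (s : ℝ) : ℝ := √(1 - 2 * M / r s)

section stat
variable {M : ℝ} {r : ℝ → ℝ}

theorem r_pos (hM : 0 < M) (hr : IsTortoise M r) (s : ℝ) : 0 < r s := by
  have := hr.1 s; linarith

theorem mu_lt (hM : 0 < M) (hr : IsTortoise M r) (s : ℝ) : 2 * M / r s < 1 := by
  rw [div_lt_one (r_pos hM hr s)]; exact hr.1 s

theorem mu_pos (hM : 0 < M) (hr : IsTortoise M r) (s : ℝ) : 0 < 2 * M / r s := by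
  have := r_pos hM hr s; positivity

theorem y_sq (hM : 0 < M) (hr : IsTortoise M r) (s : ℝ) : yS M r s ^ 2 = 1 - 2 * M / r s := by
  have := mu_lt hM hr s
  exact Real.sq_sqrt (by linarith)

theorem y_pos (hM : 0 < M) (hr : IsTortoise M r) (s : ℝ) : 0 < yS M r s := by
  have := mu_lt hM hr s
  exact Real.sqrt_pos.2 (by linarith)

theorem y_lt (hM : 0 < M) (hr : IsTortoise M r) (s : ℝ) : yS M r s < 1 := by
  have h1 := y_sq hM hr s
  have h2 := mu_pos hM hr s
  have h3 := y_pos hM hr s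
  nlinarith

theorem x_eq (hM : 0 < M) (hr : IsTortoise M r) (s : ℝ) :
    1 - yS M r s ^ 2 = 2 * M / r s := by rw [y_sq hM hr]; ring

theorem r_mul_x (hM : 0 < M) (hr : IsTortoise M r) (s : ℝ) :
    r s * (1 - yS M r s ^ 2) = 2 * M := by
  rw [x_eq hM hr]; have := r_pos hM hr s; field_simp

theorem r_smooth (hM : 0 < M) (hr : IsTortoise M r) : ContDiff ℝ (⊤ : ℕ∞) r := by
  rw [contDiff_infty]
  intro n
  induction n with
  | zero =>
    rw [Nat.cast_zero, contDiff_zero, continuous_iff_continuousAt]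
    exact fun s => (hr.2.1 s).continuousAt
  | succ n ih =>
    rw [Nat.cast_succ, contDiff_succ_iff_deriv]
    refine ⟨fun s => (hr.2.1 s).differentiableAt, by simp, ?_⟩
    have : deriv r = fun s => 1 - 2 * M / r s := funext fun s => (hr.2.1 s).deriv
    rw [this]
    exact contDiff_const.sub (contDiff_const.div ih (fun s => (r_pos hM hr s).ne'))

theorem y_smooth (hM : 0 < M) (hr : IsTortoise M r) : ContDiff ℝ (⊤ : ℕ∞) (yS M r) := by
  have h := r_smooth hM hr
  unfold yS
  apply ContDiff.sqrt
  · exact contDiff_const.sub (contDiff_const.div h (fun s => (r_pos hM hr s).ne'))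
  · intro s; have := mu_lt hM hr s; linarith

theorem y_deriv (hM : 0 < M) (hr : IsTortoise M r) (s : ℝ) :
    HasDerivAt (yS M r) (yS M r s * (1 - yS M r s ^ 2) ^ 2 / (4 * M)) s := by
  have h0 := (r_pos hM hr s)
  have h1 : HasDerivAt (fun s => 1 - 2 * M / r s) (2 * M * (1 - 2 * M / r s) / r s ^ 2) s := by
    have := ((hasDerivAt_const s (2 * M)).div (hr.2.1 s) h0.ne').const_sub 1
    refine HasDerivAt.congr_deriv this ?_
    ring
  have h2 := h1.sqrt (by have := mu_lt hM hr s; linarith)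
  have hy := y_pos hM hr s
  have e : √(1 - 2 * M / r s) = yS M r s := rfl
  rw [e] at h2
  refine HasDerivAt.congr_deriv (f := yS M r) h2 ?_
  rw [← y_sq hM hr, x_eq hM hr]
  field_simp
  ring

theorem y_mono (hM : 0 < M) (hr : IsTortoise M r) : Monotone (yS M r) := by
  apply monotone_of_deriv_nonneg (fun s => (y_deriv hM hr s).differentiableAt)
  intro s
  rw [(y_deriv hM hr s).deriv]
  have := y_pos hM hr s
  positivity

theorem y_zero (hM : 0 < M) (hr : IsTortoise M r) : yS M r 0 ^ 2 = 1 / 3 := by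
  rw [y_sq hM hr, hr.2.2]; field_simp; norm_num

theorem y_sq_ge (hM : 0 < M) (hr : IsTortoise M r) (s : ℝ) (hs : 0 ≤ s) :
    1 / 3 ≤ yS M r s ^ 2 := by
  rw [← y_zero hM hr]
  exact pow_le_pow_left₀ (y_pos hM hr 0).le (y_mono hM hr hs) 2

theorem y_sq_le (hM : 0 < M) (hr : IsTortoise M r) (s : ℝ) (hs : s ≤ 0) :
    yS M r s ^ 2 ≤ 1 / 3 := by
  rw [← y_zero hM hr]
  exact pow_le_pow_left₀ (y_pos hM hr s).le (y_mono hM hr hs) 2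

theorem r_deriv' (hM : 0 < M) (hr : IsTortoise M r) (s : ℝ) :
    HasDerivAt r (yS M r s ^ 2) s := by rw [y_sq hM hr]; exact hr.2.1 s

theorem r_ge (hM : 0 < M) (hr : IsTortoise M r) (s : ℝ) (hs : 0 ≤ s) :
    3 * M + s / 3 ≤ r s := by
  have hd : ∀ u, HasDerivAt (fun u => r u - u / 3) (yS M r u ^ 2 - 1 / 3) u := fun u =>
    (r_deriv' hM hr u).sub ((hasDerivAt_id u).div_const 3)
  have hm : MonotoneOn (fun u => r u - u / 3) (Set.Ici 0) := by
    apply monotoneOn_of_deriv_nonneg (convex_Ici 0)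
    · exact fun u _ => (hd u).continuousAt.continuousWithinAt
    · exact fun u _ => (hd u).differentiableAt.differentiableWithinAt
    · intro u hu
      rw [interior_Ici] at hu
      rw [(hd u).deriv]
      have := y_sq_ge hM hr u (le_of_lt hu)
      linarith
  have := hm (Set.mem_Ici.2 le_rfl) (Set.mem_Ici.2 hs) hs
  simp only [hr.2.2] at this
  linarith

theorem r_le (hM : 0 < M) (hr : IsTortoise M r) (s : ℝ) (hs : 0 ≤ s) :
    r s ≤ 3 * M + s := by
  have hd : ∀ u, HasDerivAt (fun u => u - r u) (1 - yS M r u ^ 2) u := fun u =>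
    (hasDerivAt_id u).sub (r_deriv' hM hr u)
  have hm : Monotone (fun u => u - r u) := by
    apply monotone_of_deriv_nonneg (fun u => (hd u).differentiableAt)
    intro u
    rw [(hd u).deriv, x_eq hM hr]
    exact (mu_pos hM hr u).le
  have := hm hs
  simp only [hr.2.2] at this
  linarith

theorem r_mono (hM : 0 < M) (hr : IsTortoise M r) : Monotone r := by
  apply monotone_of_deriv_nonneg (fun u => (r_deriv' hM hr u).differentiableAt)
  intro u
  rw [(r_deriv' hM hr u).deriv]; positivity

theorem r_le' (hM : 0 < M) (hr : IsTortoise M r) (s : ℝ) (hs : s ≤ 0) : r s ≤ 3 * M := by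
  rw [← hr.2.2]; exact r_mono hM hr hs

theorem s_le (hM : 0 < M) (hr : IsTortoise M r) (s : ℝ) : s ≤ 4 / 3 * r s + 24 * M := by
  have hrp := r_pos hM hr
  by_cases hs : s ≤ 24 * M
  · have := hrp s; linarith
  push Not at hs
  have hd : ∀ u, HasDerivAt (fun u => 4 / 3 * r u - u) (4 / 3 * yS M r u ^ 2 - 1) u := fun u =>
    ((r_deriv' hM hr u).const_mul (4 / 3)).sub (hasDerivAt_id u)
  have hm : MonotoneOn (fun u => 4 / 3 * r u - u) (Set.Ici (24 * M)) := by
    apply monotoneOn_of_deriv_nonneg (convex_Ici _)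
    · exact fun u _ => (hd u).continuousAt.continuousWithinAt
    · exact fun u _ => (hd u).differentiableAt.differentiableWithinAt
    · intro u hu
      rw [interior_Ici] at hu
      have hu' : 24 * M < u := hu
      rw [(hd u).deriv, y_sq hM hr]
      have h1 := r_ge hM hr u (by linarith)
      have h2 : 2 * M / r u ≤ 1 / 4 := by
        rw [div_le_iff₀ (hrp u)]; linarith
      linarith
  have := hm (Set.mem_Ici.2 le_rfl) (Set.mem_Ici.2 hs.le) hs.le
  have h3 := hrp (24 * M)
  simp only at this
  linarith

theorem y_exp (hM : 0 < M) (hr : IsTortoise M r) (s : ℝ) (hs : s ≤ 0) :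
    yS M r s ≤ exp (s / (9 * M)) := by
  have hd : ∀ u, HasDerivAt (fun u => yS M r u * exp (-(u / (9 * M))))
      (yS M r u * (1 - yS M r u ^ 2) ^ 2 / (4 * M) * exp (-(u / (9 * M)))
        + yS M r u * (exp (-(u / (9 * M))) * -(1 / (9 * M)))) u := fun u =>
    (y_deriv hM hr u).mul (((hasDerivAt_id u).div_const (9 * M)).neg.exp)
  have hm : MonotoneOn (fun u => yS M r u * exp (-(u / (9 * M)))) (Set.Iic 0) := by
    apply monotoneOn_of_deriv_nonneg (convex_Iic 0)
    · exact fun u _ => (hd u).continuousAt.continuousWithinAt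
    · exact fun u _ => (hd u).differentiableAt.differentiableWithinAt
    · intro u hu
      rw [interior_Iic] at hu
      rw [(hd u).deriv]
      have h1 := y_sq_le hM hr u (le_of_lt hu)
      have h2 := y_pos hM hr u
      have h3 : 1 / (9 * M) ≤ (1 - yS M r u ^ 2) ^ 2 / (4 * M) := by
        rw [div_le_div_iff₀ (by positivity) (by positivity)]
        nlinarith [mul_nonneg hM.le (sq_nonneg (yS M r u)), mul_nonneg hM.le (sub_nonneg.2 h1),
          mul_nonneg hM.le (mul_nonneg (sub_nonneg.2 h1) (sub_nonneg.2 h1))]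
      have h4 : 0 < yS M r u * exp (-(u / (9 * M))) := by positivity
      have : yS M r u * (1 - yS M r u ^ 2) ^ 2 / (4 * M) * exp (-(u / (9 * M)))
        + yS M r u * (exp (-(u / (9 * M))) * -(1 / (9 * M)))
        = (yS M r u * exp (-(u / (9 * M)))) * ((1 - yS M r u ^ 2) ^ 2 / (4 * M) - 1 / (9 * M)) := by
        ring
      rw [this]
      exact mul_nonneg h4.le (by linarith)
  have := hm (Set.mem_Iic.2 hs) (Set.mem_Iic.2 le_rfl) hs
  simp only [zero_div, neg_zero, exp_zero, mul_one] at this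
  have h5 := y_lt hM hr 0
  have h6 : yS M r s * exp (-(s / (9 * M))) ≤ 1 := by linarith
  rw [exp_neg, ← div_eq_mul_inv, div_le_one (exp_pos _)] at h6
  exact h6

/-- uniform bound `y (1 + |s| x)^4 ≤ C` -/
theorem stat_U (hM : 0 < M) (hr : IsTortoise M r) :
    ∃ C : ℝ, 0 < C ∧ ∀ s, yS M r s * (1 + |s| * (1 - yS M r s ^ 2)) ^ 4 ≤ C := by
  have hk : 0 < 1 / (9 * M) := by positivity
  refine ⟨(1 + 6 * M) ^ 4 + 24 * exp (1 / (9 * M)) / (1 / (9 * M)) ^ 4, by positivity, ?_⟩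
  intro s
  have hy := y_pos hM hr s
  have hy1 := y_lt hM hr s
  have hx := mu_pos hM hr s
  rw [x_eq hM hr]
  rcases le_total 0 s with hs | hs
  · have h1 : |s| * (2 * M / r s) ≤ 6 * M := by
      rw [abs_of_nonneg hs, ← mul_div_assoc, div_le_iff₀ (r_pos hM hr s)]
      have := r_ge hM hr s hs
      nlinarith
    have h2 : (1 + |s| * (2 * M / r s)) ^ 4 ≤ (1 + 6 * M) ^ 4 := by gcongr
    have h3 : 0 < 24 * exp (1 / (9 * M)) / (1 / (9 * M)) ^ 4 := by positivity
    have h4 : 0 ≤ (1 + |s| * (2 * M / r s)) ^ 4 := by positivity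
    nlinarith
  · have hx1 := mu_lt hM hr s
    have h2 : (1 + |s| * (2 * M / r s)) ^ 4 ≤ (1 + |s|) ^ 4 := by
      gcongr
      exact mul_le_of_le_one_right (abs_nonneg s) hx1.le
    have h3 := y_exp hM hr s hs
    have h4 := Real.pow_div_factorial_le_exp (1 / (9 * M) * (1 + |s|)) (by positivity) 4
    have h5 : exp (1 / (9 * M) * (1 + |s|)) * exp (s / (9 * M)) = exp (1 / (9 * M)) := by
      rw [← exp_add, abs_of_nonpos hs]; congr 1; ring
    have h6 : (1 / (9 * M)) ^ 4 * (1 + |s|) ^ 4 ≤ 24 * exp (1 / (9 * M) * (1 + |s|)) := by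
      rw [mul_pow] at h4
      have : ((Nat.factorial 4 : ℕ) : ℝ) = 24 := by norm_num [Nat.factorial]
      rw [this] at h4
      linarith
    have h7 : yS M r s * (1 + |s|) ^ 4 ≤ 24 * exp (1 / (9 * M)) / (1 / (9 * M)) ^ 4 := by
      rw [le_div_iff₀ (by positivity)]
      calc yS M r s * (1 + |s|) ^ 4 * (1 / (9 * M)) ^ 4
          ≤ exp (s / (9 * M)) * ((1 / (9 * M)) ^ 4 * (1 + |s|) ^ 4) := by
            have : 0 ≤ (1 / (9 * M)) ^ 4 * (1 + |s|) ^ 4 := by positivity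
            nlinarith
        _ ≤ exp (s / (9 * M)) * (24 * exp (1 / (9 * M) * (1 + |s|))) := by gcongr
        _ = 24 * exp (1 / (9 * M)) := by rw [← h5]; ring
    have h8 : yS M r s * (1 + |s| * (2 * M / r s)) ^ 4 ≤ yS M r s * (1 + |s|) ^ 4 := by gcongr
    have h9 : 0 < (1 + 6 * M) ^ 4 := by positivity
    linarith

/-- the bad set of the conformal multiplier is compact -/
theorem stat_bad (hM : 0 < M) (hr : IsTortoise M r) (s : ℝ)
    (hb : 0 < 2 - s * (1 - yS M r s ^ 2) / (2 * M) * (3 - 4 * (1 - yS M r s ^ 2))) :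
    |s| ≤ 51 * M ∧ 1 / 27 ≤ 1 - yS M r s ^ 2 := by
  have hrp := r_pos hM hr s
  have habs : |s| ≤ 51 * M := by
    by_contra hcon
    push Not at hcon
    rcases le_total 0 s with hs | hs
    · rw [abs_of_nonneg hs] at hcon
      have h1 := r_ge hM hr s hs
      have h2 := r_le hM hr s hs
      have h3 : s * (1 - yS M r s ^ 2) / (2 * M) = s / r s := by
        rw [x_eq hM hr]; field_simp
      have h4 : 1 - yS M r s ^ 2 ≤ 1 / 10 := by
        rw [x_eq hM hr, div_le_iff₀ hrp]; linarith
      have h5 : 17 / 20 ≤ s / r s := by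
        rw [le_div_iff₀ hrp]; linarith
      rw [h3] at hb
      nlinarith
    · rw [abs_of_nonpos hs] at hcon
      have h1 := y_exp hM hr s hs
      have h0 := y_pos hM hr s
      have h2 : yS M r s ^ 2 ≤ 1 / 8 := by
        have h3 : exp (s / (9 * M)) ^ 2 * exp (7 : ℝ) ≤ 1 := by
          rw [← exp_nat_mul, ← exp_add, ← exp_zero]
          apply exp_le_exp.2
          have : s / (9 * M) ≤ -(51 / 9) := by
            rw [div_le_iff₀ (by positivity)]; linarith
          push_cast; linarith
        have h4 := add_one_le_exp (7 : ℝ)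
        have h5 : yS M r s ^ 2 ≤ exp (s / (9 * M)) ^ 2 := pow_le_pow_left₀ h0.le h1 2
        have h6 : 0 < exp (s / (9 * M)) ^ 2 := by positivity
        nlinarith
      have h3 : s * (1 - yS M r s ^ 2) / (2 * M) ≤ -22 := by
        rw [div_le_iff₀ (by positivity)]
        nlinarith
      nlinarith
  refine ⟨habs, ?_⟩
  have h1 : r s ≤ 54 * M := by
    rcases le_total 0 s with hs | hs
    · have := r_le hM hr s hs
      rw [abs_of_nonneg hs] at habs; linarith
    · have := r_le' hM hr s hs; linarith
  rw [x_eq hM hr, le_div_iff₀ hrp]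
  linarith

/-- algebraic fact behind the Hardy inequality -/
theorem stat_hardy (hM : 0 < M) (hr : IsTortoise M r) (t s : ℝ) (ht : 1 ≤ t) :
    1 / 2 * (t ^ 2 + s ^ 2) - (40 + 5 * M) * (1 - yS M r s ^ 2) * (t ^ 2 + s ^ 2)
      ≤ 2 * s * r s - (s ^ 2 - t ^ 2) * (1 - 2 * (1 - yS M r s ^ 2)) := by
  have hrp := r_pos hM hr s
  have hx0 := mu_pos hM hr s
  have hx1 := mu_lt hM hr s
  have hrx := r_mul_x hM hr s
  rcases le_total 0 s with hs | hs
  · rw [x_eq hM hr] at *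
    set x := 2 * M / r s
    have key : s * (3 / 2) ≤ 2 * r s + 38 * (x * s) := by
      have h1 := s_le hM hr s
      have h2 := r_ge hM hr s hs
      have h3 := r_le hM hr s hs
      rcases le_total s (3 * M) with h | h
      · have : 0 ≤ x * s := by positivity
        linarith
      · have : M ≤ x * s := by
          have : x * s = 2 * M * s / r s := by simp only [x]; ring
          rw [this, le_div_iff₀ hrp]
          nlinarith
        linarith
    have k2 := mul_le_mul_of_nonneg_left key hs
    have k3 : 0 ≤ M * x * (t ^ 2 + s ^ 2) := by positivity
    have k4 : 0 ≤ x * t ^ 2 := by positivity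
    have k5 : 0 ≤ t ^ 2 := by positivity
    nlinarith
  · have h1 := r_le' hM hr s hs
    have h2 := y_sq_le hM hr s hs
    have h0 := y_pos hM hr s
    set x := 1 - yS M r s ^ 2
    have hx2 : 2 / 3 ≤ x := by simp only [x]; linarith
    have hx3 : x ≤ 1 := by simp only [x]; nlinarith
    have k1 : -(2 * s) * r s ≤ 3 * M * (t ^ 2 + s ^ 2) := by
      have : -(2 * s) ≤ t ^ 2 + s ^ 2 := by nlinarith [sq_nonneg (s + 1)]
      have h3 : 0 ≤ -(2 * s) := by linarith
      nlinarith
    have k2 : (40 + 5 * M) * (2 / 3) * (t ^ 2 + s ^ 2) ≤ (40 + 5 * M) * x * (t ^ 2 + s ^ 2) := by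
      gcongr
    have k3 : 0 ≤ M * (t ^ 2 + s ^ 2) := by positivity
    have k4 : (s ^ 2 - t ^ 2) * (1 - 2 * x) ≤ t ^ 2 + s ^ 2 := by
      nlinarith [sq_nonneg s, sq_nonneg t]
    nlinarith [sq_nonneg s, sq_nonneg t]
end stat

/-! coefficient functions; `L` plays the role of `2M`, `y = √(1-μ)` -/
def cV (L y : ℝ) : ℝ := y ^ 2 * (1 - y ^ 2) ^ 3 / L ^ 2
def cV1 (L y : ℝ) : ℝ := y ^ 2 * (1 - y ^ 2) ^ 4 * (4 * (1 - y ^ 2) - 3) / L ^ 3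
def cF (y : ℝ) : ℝ := 10 * y ^ 2 + 2 * y - 5
def cH (L y : ℝ) : ℝ := 3 * y ^ 2 * (1 - y ^ 2) ^ 2 / L
def cH1 (L y : ℝ) : ℝ := 3 * y ^ 2 * (1 - y ^ 2) ^ 3 * (3 * (1 - y ^ 2) - 2) / L ^ 2
def cH2 (L y : ℝ) : ℝ :=
  3 * y ^ 2 * (1 - y ^ 2) ^ 4 * (15 * (1 - y ^ 2) ^ 2 - 20 * (1 - y ^ 2) + 6) / L ^ 3
def cF1 (L y : ℝ) : ℝ := (10 * y + 1) * y * (1 - y ^ 2) ^ 2 / L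
def cZ (y : ℝ) : ℝ := 1 - 3 / 2 * y - 2 * y ^ 2 + 9 / 2 * y ^ 3 - 1 / 2 * y ^ 4
def tau (t s : ℝ) : ℝ := (t ^ 2 - s ^ 2) ^ 4 / (t ^ 2 + s ^ 2) ^ 3
def tauT (t s : ℝ) : ℝ := 8 * t * (t ^ 2 - s ^ 2) ^ 3 / (t ^ 2 + s ^ 2) ^ 3
  - 6 * t * (t ^ 2 - s ^ 2) ^ 4 / (t ^ 2 + s ^ 2) ^ 4
def tauS (t s : ℝ) : ℝ := -(8 * s * (t ^ 2 - s ^ 2) ^ 3 / (t ^ 2 + s ^ 2) ^ 3)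
  - 6 * s * (t ^ 2 - s ^ 2) ^ 4 / (t ^ 2 + s ^ 2) ^ 4

/-- conformal energy density -/
def eN (L t s y a b c : ℝ) : ℝ :=
  1 / 2 * (t ^ 2 + s ^ 2) * (b ^ 2 + c ^ 2 + cV L y * a ^ 2) + 2 * t * s * (b * c)
/-- Morawetz density -/
def eM (L t s y a b c : ℝ) : ℝ := tau t s * (cF y * (b * c) + cH L y * (a * b))
def eP (ε L t s y a b c : ℝ) : ℝ := eN L t s y a b c + ε * eM L t s y a b c
def eQ (ε L t s y a b c : ℝ) : ℝ :=
  -((t ^ 2 + s ^ 2) * (b * c) + t * s * (b ^ 2 + c ^ 2 - cV L y * a ^ 2))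
  + ε * (tau t s * (-(1 / 2 * cF y * (b ^ 2 + c ^ 2 - cV L y * a ^ 2)) - cH L y * (a * c)
    + 1 / 2 * cH1 L y * a ^ 2))
def eBulk (L y a b c : ℝ) : ℝ :=
  y * (1 - y ^ 2) ^ 2 / L * (2 * y + 1 / 2) * b ^ 2
  + y * (1 - y ^ 2) ^ 2 / L * (8 * y + 1 / 2) * c ^ 2
  + y ^ 2 * (1 - y ^ 2) ^ 4 * cZ y / L ^ 3 * a ^ 2
def eErr (L t s y a b c : ℝ) : ℝ :=
  tauT t s * (cF y * (b * c) + cH L y * (a * b))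
  + tauS t s * (-(1 / 2 * cF y * (b ^ 2 + c ^ 2 - cV L y * a ^ 2)) - cH L y * (a * c)
    + 1 / 2 * cH1 L y * a ^ 2)

theorem tau_derivT (t s : ℝ) (h : t ^ 2 + s ^ 2 ≠ 0) :
    HasDerivAt (fun t => tau t s) (tauT t s) t := by
  have h1 : HasDerivAt (fun t : ℝ => t ^ 2) (2 * t) t := by simpa using hasDerivAt_pow 2 t
  have h2 := ((h1.sub_const (s ^ 2)).fun_pow 4).div ((h1.add_const (s ^ 2)).fun_pow 3)
    (pow_ne_zero 3 h)
  refine HasDerivAt.congr_deriv h2 ?_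
  unfold tauT
  push_cast
  field_simp
  ring

theorem tau_derivS (t s : ℝ) (h : t ^ 2 + s ^ 2 ≠ 0) :
    HasDerivAt (fun s => tau t s) (tauS t s) s := by
  have h1 : HasDerivAt (fun t : ℝ => t ^ 2) (2 * s) s := by simpa using hasDerivAt_pow 2 s
  have h2 := ((h1.const_sub (t ^ 2)).fun_pow 4).div ((h1.const_add (t ^ 2)).fun_pow 3)
    (pow_ne_zero 3 h)
  refine HasDerivAt.congr_deriv h2 ?_
  unfold tauS
  push_cast
  field_simp
  ring

section coef
variable {L s : ℝ} {y : ℝ → ℝ}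

theorem cF_deriv (hy : HasDerivAt y (y s * (1 - y s ^ 2) ^ 2 / (2 * L)) s) :
    HasDerivAt (fun s => cF (y s)) (cF1 L (y s)) s := by
  have := (((hy.fun_pow 2).const_mul 10).add (hy.const_mul 2)).sub_const 5
  refine HasDerivAt.congr_deriv this ?_
  unfold cF1; push_cast; ring

theorem cV_deriv (hy : HasDerivAt y (y s * (1 - y s ^ 2) ^ 2 / (2 * L)) s) :
    HasDerivAt (fun s => cV L (y s)) (cV1 L (y s)) s := by
  have := (((hy.fun_pow 2)).mul (((hy.fun_pow 2).const_sub 1).fun_pow 3)).div_const (L ^ 2)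
  refine HasDerivAt.congr_deriv this ?_
  unfold cV1; push_cast; ring

theorem cH_deriv (hy : HasDerivAt y (y s * (1 - y s ^ 2) ^ 2 / (2 * L)) s) :
    HasDerivAt (fun s => cH L (y s)) (cH1 L (y s)) s := by
  have := (((hy.fun_pow 2).const_mul 3).mul (((hy.fun_pow 2).const_sub 1).fun_pow 2)).div_const L
  refine HasDerivAt.congr_deriv this ?_
  unfold cH1; push_cast; ring

theorem cH1_deriv (hy : HasDerivAt y (y s * (1 - y s ^ 2) ^ 2 / (2 * L)) s) :
    HasDerivAt (fun s => cH1 L (y s)) (cH2 L (y s)) s := by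
  have := ((((hy.fun_pow 2).const_mul 3).mul (((hy.fun_pow 2).const_sub 1).fun_pow 3)).mul
    ((((hy.fun_pow 2).const_sub 1).const_mul 3).sub_const 2)).div_const (L ^ 2)
  refine HasDerivAt.congr_deriv this ?_
  unfold cH2; simp only [Pi.mul_apply, Pi.sub_apply]; push_cast; ring
end coef

theorem eP_derivT (ε L t s y : ℝ) (a b c : ℝ → ℝ) (a' b' c' : ℝ) (h : t ^ 2 + s ^ 2 ≠ 0)
    (ha : HasDerivAt a a' t) (hb : HasDerivAt b b' t) (hc : HasDerivAt c c' t) :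
    HasDerivAt (fun t => eP ε L t s y (a t) (b t) (c t))
      (t * (b t ^ 2 + c t ^ 2 + cV L y * a t ^ 2)
        + (t ^ 2 + s ^ 2) * (b t * b' + c t * c' + cV L y * (a t * a'))
        + 2 * s * (b t * c t) + 2 * t * s * (b' * c t + b t * c')
        + ε * (tauT t s * (cF y * (b t * c t) + cH L y * (a t * b t))
          + tau t s * (cF y * (b' * c t + b t * c') + cH L y * (a' * b t + a t * b')))) t := by
  have h1 : HasDerivAt (fun t : ℝ => t ^ 2) (2 * t) t := by simpa using hasDerivAt_pow 2 t
  have hN := (((h1.add_const (s ^ 2)).const_mul (1 / 2)).mul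
    (((hb.fun_pow 2).add (hc.fun_pow 2)).add ((ha.fun_pow 2).const_mul (cV L y)))).add
    ((((hasDerivAt_id t).const_mul 2).mul_const s).mul (hb.mul hc))
  have hMo := (tau_derivT t s h).mul (((hb.mul hc).const_mul (cF y)).add
    ((ha.mul hb).const_mul (cH L y)))
  refine HasDerivAt.congr_deriv (hN.add (hMo.const_mul ε)) ?_
  simp only [Pi.add_apply, Pi.mul_apply, id]
  push_cast
  ring

theorem eQ_derivS (ε L t s : ℝ) (y a b c : ℝ → ℝ) (a' b' c' : ℝ) (h : t ^ 2 + s ^ 2 ≠ 0)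
    (hy : HasDerivAt y (y s * (1 - y s ^ 2) ^ 2 / (2 * L)) s)
    (ha : HasDerivAt a a' s) (hb : HasDerivAt b b' s) (hc : HasDerivAt c c' s) :
    HasDerivAt (fun s => eQ ε L t s (y s) (a s) (b s) (c s))
      (-(2 * s * (b s * c s) + (t ^ 2 + s ^ 2) * (b' * c s + b s * c')
          + t * (b s ^ 2 + c s ^ 2 - cV L (y s) * a s ^ 2)
          + t * s * (2 * (b s * b') + 2 * (c s * c') - cV1 L (y s) * a s ^ 2
            - 2 * cV L (y s) * (a s * a')))
        + ε * (tauS t s * (-(1 / 2 * cF (y s) * (b s ^ 2 + c s ^ 2 - cV L (y s) * a s ^ 2))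
            - cH L (y s) * (a s * c s) + 1 / 2 * cH1 L (y s) * a s ^ 2)
          + tau t s * (-(1 / 2 * cF1 L (y s) * (b s ^ 2 + c s ^ 2 - cV L (y s) * a s ^ 2))
            - (1 / 2 * cF (y s) * (2 * (b s * b') + 2 * (c s * c') - cV1 L (y s) * a s ^ 2
            - 2 * cV L (y s) * (a s * a')))
            - cH1 L (y s) * (a s * c s) - cH L (y s) * (a' * c s + a s * c')
            + 1 / 2 * cH2 L (y s) * a s ^ 2 + cH1 L (y s) * (a s * a')))) s := by
  have h1 : HasDerivAt (fun t : ℝ => t ^ 2) (2 * s) s := by simpa using hasDerivAt_pow 2 s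
  have hE := ((hb.fun_pow 2).add (hc.fun_pow 2)).sub ((cV_deriv hy).mul (ha.fun_pow 2))
  have hN := (((h1.const_add (t ^ 2)).mul (hb.mul hc)).add
    (((hasDerivAt_id s).const_mul t).mul hE)).neg
  have hMo := (tau_derivS t s h).mul ((((((cF_deriv hy).const_mul (1 / 2)).mul hE).neg).sub
    ((cH_deriv hy).mul (ha.mul hc))).add (((cH1_deriv hy).const_mul (1 / 2)).mul (ha.fun_pow 2)))
  refine HasDerivAt.congr_deriv (hN.add (hMo.const_mul ε)) ?_
  simp only [Pi.add_apply, Pi.mul_apply, Pi.sub_apply, Pi.neg_apply, id]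
  push_cast
  ring

/-- the divergence identity -/
theorem div_identity (ε L t s y : ℝ) (a b c tt ts ss f : ℝ)
    (heq : tt = ss - cV L y * a + f) :
      (t * (b ^ 2 + c ^ 2 + cV L y * a ^ 2)
        + (t ^ 2 + s ^ 2) * (b * tt + c * ts + cV L y * (a * b))
        + 2 * s * (b * c) + 2 * t * s * (tt * c + b * ts)
        + ε * (tauT t s * (cF y * (b * c) + cH L y * (a * b))
          + tau t s * (cF y * (tt * c + b * ts) + cH L y * (b * b + a * tt))))
      + (-(2 * s * (b * c) + (t ^ 2 + s ^ 2) * (ts * c + b * ss)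
          + t * (b ^ 2 + c ^ 2 - cV L y * a ^ 2)
          + t * s * (2 * (b * ts) + 2 * (c * ss) - cV1 L y * a ^ 2
            - 2 * cV L y * (a * c)))
        + ε * (tauS t s * (-(1 / 2 * cF y * (b ^ 2 + c ^ 2 - cV L y * a ^ 2))
            - cH L y * (a * c) + 1 / 2 * cH1 L y * a ^ 2)
          + tau t s * (-(1 / 2 * cF1 L y * (b ^ 2 + c ^ 2 - cV L y * a ^ 2))
            - (1 / 2 * cF y * (2 * (b * ts) + 2 * (c * ss) - cV1 L y * a ^ 2
            - 2 * cV L y * (a * c)))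
            - cH1 L y * (a * c) - cH L y * (c * c + a * ss)
            + 1 / 2 * cH2 L y * a ^ 2 + cH1 L y * (a * c))))
      = f * ((t ^ 2 + s ^ 2) * b + 2 * t * s * c + ε * tau t s * (cF y * c + cH L y * a))
        + t * (2 * cV L y + s * cV1 L y) * a ^ 2
        - ε * (tau t s * eBulk L y a b c) + ε * eErr L t s y a b c := by
  have e1 : 1 / 2 * cF1 L y - cH L y = y * (1 - y ^ 2) ^ 2 / L * (2 * y + 1 / 2) := by
    unfold cF1 cH; ring
  have e2 : 1 / 2 * cF1 L y + cH L y = y * (1 - y ^ 2) ^ 2 / L * (8 * y + 1 / 2) := by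
    unfold cF1 cH; ring
  have e3 : cH L y * cV L y - 1 / 2 * (cF1 L y * cV L y + cF y * cV1 L y) - 1 / 2 * cH2 L y
      = y ^ 2 * (1 - y ^ 2) ^ 4 * cZ y / L ^ 3 := by
    unfold cF1 cH cV cF cV1 cH2 cZ; ring
  unfold eBulk eErr
  rw [← e1, ← e2, ← e3, heq]
  ring

theorem amgm (u v k : ℝ) (hk : 0 < k) : |u * v| ≤ k * u ^ 2 + v ^ 2 / (4 * k) := by
  have h : 0 ≤ (2 * k * |u| - |v|) ^ 2 / (4 * k) := by positivity
  rw [abs_mul]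
  have e : (2 * k * |u| - |v|) ^ 2 / (4 * k) = k * |u| ^ 2 + |v| ^ 2 / (4 * k) - |u| * |v| := by
    field_simp; ring
  rw [e, sq_abs, sq_abs] at h
  linarith

theorem eN_eq (L t s y a b c : ℝ) : eN L t s y a b c =
    1 / 4 * ((t - s) ^ 2 * (b - c) ^ 2) + 1 / 4 * ((t + s) ^ 2 * (b + c) ^ 2)
      + 1 / 2 * (t ^ 2 + s ^ 2) * (cV L y * a ^ 2) := by
  unfold eN; ring

theorem cV_nonneg (L y : ℝ) (hy0 : 0 < y) (hy1 : y < 1) : 0 ≤ cV L y := by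
  have hx : 0 ≤ 1 - y ^ 2 := by nlinarith
  unfold cV; positivity

theorem eN_nonneg (L t s y a b c : ℝ) (hy0 : 0 < y) (hy1 : y < 1) : 0 ≤ eN L t s y a b c := by
  have := cV_nonneg L y hy0 hy1
  rw [eN_eq]; positivity

theorem min_eN (L t s y a b c m k : ℝ) (hy0 : 0 < y) (hy1 : y < 1)
    (h1 : m ≤ k * (t + s) ^ 2) (h2 : m ≤ k * (t - s) ^ 2) :
    m * (b ^ 2 + c ^ 2 + cV L y * a ^ 2) ≤ 2 * k * eN L t s y a b c := by
  have hV : 0 ≤ cV L y * a ^ 2 := mul_nonneg (cV_nonneg L y hy0 hy1) (sq_nonneg a)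
  have e1 := mul_le_mul_of_nonneg_right h1 (sq_nonneg (b + c))
  have e2 := mul_le_mul_of_nonneg_right h2 (sq_nonneg (b - c))
  have e3 := mul_le_mul_of_nonneg_right h1 hV
  have e4 := mul_le_mul_of_nonneg_right h2 hV
  rw [eN_eq]
  nlinarith

theorem tau_nonneg (t s : ℝ) : 0 ≤ tau t s := by unfold tau; positivity

theorem tb_aux {t s : ℝ} (_ : 0 < t) : |t ^ 2 - s ^ 2| ≤ t ^ 2 + s ^ 2 ∧ (t - s) ^ 2 ≤ 2 * (t ^ 2 + s ^ 2) ∧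
    (t + s) ^ 2 ≤ 2 * (t ^ 2 + s ^ 2) ∧ |t * s| ≤ t ^ 2 + s ^ 2 := by
  refine ⟨?_, ?_, ?_, ?_⟩
  · rw [abs_le]; constructor <;> nlinarith
  · nlinarith [sq_nonneg (t + s)]
  · nlinarith [sq_nonneg (t - s)]
  · rw [abs_le]; constructor <;> nlinarith [sq_nonneg (t - s), sq_nonneg (t + s)]

/-- basic cubic bound -/
theorem cub_le (p q w : ℝ) (hw : 0 < w) (h1 : |p * q| ≤ w) (h2 : q ^ 2 ≤ 2 * w) :
    |p * q| ^ 3 / w ^ 2 ≤ 2 * p ^ 2 := by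
  rw [div_le_iff₀ (by positivity)]
  have e : |p * q| ^ 3 = p ^ 2 * (|p * q| * q ^ 2) := by
    have : |p * q| ^ 3 = |p * q| * (|p * q|) ^ 2 := by ring
    rw [this, sq_abs]; ring
  rw [e]
  have := mul_le_mul h1 h2 (sq_nonneg q) hw.le
  nlinarith [sq_nonneg p, mul_le_mul_of_nonneg_left this (sq_nonneg p)]

theorem tau_le_cub (t s : ℝ) (ht : 0 < t) :
    tau t s ≤ |t ^ 2 - s ^ 2| ^ 3 / (t ^ 2 + s ^ 2) ^ 2 := by
  obtain ⟨h1, -⟩ := tb_aux (s := s) ht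
  have hw : 0 < t ^ 2 + s ^ 2 := by positivity
  unfold tau
  rw [div_le_div_iff₀ (by positivity) (by positivity)]
  have : (t ^ 2 - s ^ 2) ^ 4 = |t ^ 2 - s ^ 2| ^ 3 * |t ^ 2 - s ^ 2| := by
    rw [← pow_succ]; norm_num
    rw [show (4 : ℕ) = 2 * 2 from rfl, pow_mul, pow_mul, sq_abs]
  rw [this]
  have h3 : 0 ≤ |t ^ 2 - s ^ 2| ^ 3 * (t ^ 2 + s ^ 2) ^ 2 := by positivity
  nlinarith [mul_le_mul_of_nonneg_left h1 h3]

theorem tauT_le_cub (t s : ℝ) (ht : 0 < t) :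
    t * |tauT t s| ≤ 14 * (|t ^ 2 - s ^ 2| ^ 3 / (t ^ 2 + s ^ 2) ^ 2) := by
  have h2 := tau_le_cub t s ht
  have h0 := tau_nonneg t s
  have hw : 0 < t ^ 2 + s ^ 2 := by positivity
  set w := t ^ 2 + s ^ 2 with hwd
  have hr : t ^ 2 / w ≤ 1 := by rw [div_le_one hw]; nlinarith [sq_nonneg s]
  have hr0 : 0 ≤ t ^ 2 / w := by positivity
  have e : t * tauT t s = 8 * (t ^ 2 / w) * ((t ^ 2 - s ^ 2) ^ 3 / w ^ 2)
      - 6 * (t ^ 2 / w) * tau t s := by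
    unfold tauT tau; rw [← hwd]; field_simp
  have : t * |tauT t s| = |t * tauT t s| := by rw [abs_mul, abs_of_pos ht]
  rw [this, e]
  have hc : |(t ^ 2 - s ^ 2) ^ 3 / w ^ 2| = |t ^ 2 - s ^ 2| ^ 3 / w ^ 2 := by
    rw [abs_div, abs_pow, abs_of_pos (by positivity : 0 < w ^ 2)]
  have hc0 : 0 ≤ |t ^ 2 - s ^ 2| ^ 3 / w ^ 2 := by positivity
  calc _ ≤ |8 * (t ^ 2 / w) * ((t ^ 2 - s ^ 2) ^ 3 / w ^ 2)| + |6 * (t ^ 2 / w) * tau t s| :=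
        abs_sub _ _
    _ = 8 * (t ^ 2 / w) * (|t ^ 2 - s ^ 2| ^ 3 / w ^ 2) + 6 * (t ^ 2 / w) * tau t s := by
        rw [abs_mul, hc, abs_of_nonneg (by positivity : 0 ≤ 8 * (t ^ 2 / w)),
          abs_of_nonneg (by positivity : 0 ≤ 6 * (t ^ 2 / w) * tau t s)]
    _ ≤ _ := by nlinarith [mul_le_mul_of_nonneg_right hr hc0, mul_le_mul_of_nonneg_right hr h0]

theorem tauS_le_cub (t s : ℝ) (ht : 0 < t) :
    t * |tauS t s| ≤ 14 * (|t ^ 2 - s ^ 2| ^ 3 / (t ^ 2 + s ^ 2) ^ 2) := by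
  have h2 := tau_le_cub t s ht
  have h0 := tau_nonneg t s
  have hts := (tb_aux (s := s) ht).2.2.2
  have hw : 0 < t ^ 2 + s ^ 2 := by positivity
  set w := t ^ 2 + s ^ 2 with hwd
  have hr : |t * s| / w ≤ 1 := by rw [div_le_one hw]; exact hts
  have hr0 : 0 ≤ |t * s| / w := by positivity
  have e : t * tauS t s = -(8 * ((t * s) / w) * ((t ^ 2 - s ^ 2) ^ 3 / w ^ 2))
      - 6 * ((t * s) / w) * tau t s := by
    unfold tauS tau; rw [← hwd]; field_simp
  have : t * |tauS t s| = |t * tauS t s| := by rw [abs_mul, abs_of_pos ht]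
  rw [this, e]
  have hc : |(t ^ 2 - s ^ 2) ^ 3 / w ^ 2| = |t ^ 2 - s ^ 2| ^ 3 / w ^ 2 := by
    rw [abs_div, abs_pow, abs_of_pos (by positivity : 0 < w ^ 2)]
  have hd : |t * s / w| = |t * s| / w := by rw [abs_div, abs_of_pos hw]
  have hc0 : 0 ≤ |t ^ 2 - s ^ 2| ^ 3 / w ^ 2 := by positivity
  calc _ ≤ |-(8 * (t * s / w) * ((t ^ 2 - s ^ 2) ^ 3 / w ^ 2))| + |6 * (t * s / w) * tau t s| :=
        abs_sub _ _
    _ = 8 * (|t * s| / w) * (|t ^ 2 - s ^ 2| ^ 3 / w ^ 2) + 6 * (|t * s| / w) * tau t s := by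
        rw [abs_neg, abs_mul, hc, abs_mul, abs_mul, abs_mul, hd, abs_of_nonneg h0]
        norm_num
    _ ≤ _ := by nlinarith [mul_le_mul_of_nonneg_right hr hc0, mul_le_mul_of_nonneg_right hr h0]

theorem cub_le_p (t s : ℝ) (ht : 0 < t) :
    |t ^ 2 - s ^ 2| ^ 3 / (t ^ 2 + s ^ 2) ^ 2 ≤ 2 * (t + s) ^ 2 := by
  obtain ⟨h1, h2, h3, h4⟩ := tb_aux (s := s) ht
  have e : t ^ 2 - s ^ 2 = (t + s) * (t - s) := by ring
  rw [e] at h1 ⊢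
  exact cub_le _ _ _ (by positivity) h1 h2

theorem cub_le_q (t s : ℝ) (ht : 0 < t) :
    |t ^ 2 - s ^ 2| ^ 3 / (t ^ 2 + s ^ 2) ^ 2 ≤ 2 * (t - s) ^ 2 := by
  obtain ⟨h1, h2, h3, h4⟩ := tb_aux (s := s) ht
  have e : t ^ 2 - s ^ 2 = (t - s) * (t + s) := by ring
  rw [e] at h1 ⊢
  exact cub_le _ _ _ (by positivity) h1 h3


theorem cF_abs {y : ℝ} (hy0 : 0 < y) (hy1 : y < 1) : |cF y| ≤ 7 := by
  unfold cF; rw [abs_le]; constructor <;> nlinarith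

theorem cH_sq {L y : ℝ} (hy0 : 0 < y) (hy1 : y < 1) : cH L y ^ 2 ≤ 9 * cV L y := by
  have hx : 0 ≤ 1 - y ^ 2 := by nlinarith
  have hx1 : 1 - y ^ 2 ≤ 1 := by nlinarith
  have e : cH L y ^ 2 = 9 * cV L y * (y ^ 2 * (1 - y ^ 2)) := by unfold cH cV; ring
  have h2 : y ^ 2 * (1 - y ^ 2) ≤ 1 := by nlinarith
  rw [e]
  have := cV_nonneg L y hy0 hy1
  nlinarith

theorem cH1_abs {L y : ℝ} (hy0 : 0 < y) (hy1 : y < 1) : |cH1 L y| ≤ 6 * cV L y := by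
  have hx : 0 ≤ 1 - y ^ 2 := by nlinarith
  have hx1 : 1 - y ^ 2 ≤ 1 := by nlinarith
  have e : cH1 L y = 3 * cV L y * (3 * (1 - y ^ 2) - 2) := by unfold cH1 cV; ring
  have := cV_nonneg L y hy0 hy1
  rw [e, abs_le]; constructor <;> nlinarith

theorem brack1 {L y : ℝ} (hy0 : 0 < y) (hy1 : y < 1) (a b c : ℝ) : |cF y * (b * c) + cH L y * (a * b)| ≤
    9 / 2 * (b ^ 2 + c ^ 2 + cV L y * a ^ 2) := by
  have hV := cV_nonneg L y hy0 hy1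
  have h1 : |cF y * (b * c)| ≤ 7 / 2 * (b ^ 2 + c ^ 2) := by
    have e : |b * c| ≤ 1 / 2 * (b ^ 2 + c ^ 2) := by
      rw [abs_le]; constructor <;> nlinarith [sq_nonneg (b - c), sq_nonneg (b + c)]
    rw [abs_mul]
    have := mul_le_mul (cF_abs hy0 hy1) e (abs_nonneg _) (by norm_num)
    linarith
  have h2 : |cH L y * (a * b)| ≤ 9 / 2 * (cV L y * a ^ 2) + 1 / 2 * b ^ 2 := by
    have e := mul_le_mul_of_nonneg_right (cH_sq (L := L) hy0 hy1) (sq_nonneg a)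
    rw [abs_le]; constructor <;>
      nlinarith [sq_nonneg (cH L y * a - b), sq_nonneg (cH L y * a + b)]
  have h3 := abs_add_le (cF y * (b * c)) (cH L y * (a * b))
  nlinarith [sq_nonneg a, sq_nonneg b, sq_nonneg c]

theorem brack2 {L y : ℝ} (hy0 : 0 < y) (hy1 : y < 1) (a b c : ℝ) : |-(1 / 2 * cF y * (b ^ 2 + c ^ 2 - cV L y * a ^ 2))
    - cH L y * (a * c) + 1 / 2 * cH1 L y * a ^ 2| ≤
    11 * (b ^ 2 + c ^ 2 + cV L y * a ^ 2) := by
  have hV := cV_nonneg L y hy0 hy1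
  have hVa : 0 ≤ cV L y * a ^ 2 := by positivity
  have h1 : |1 / 2 * cF y * (b ^ 2 + c ^ 2 - cV L y * a ^ 2)| ≤
      7 / 2 * (b ^ 2 + c ^ 2 + cV L y * a ^ 2) := by
    have e : |b ^ 2 + c ^ 2 - cV L y * a ^ 2| ≤ b ^ 2 + c ^ 2 + cV L y * a ^ 2 := by
      rw [abs_le]; constructor <;> nlinarith [sq_nonneg b, sq_nonneg c]
    rw [mul_assoc, abs_mul, abs_mul, abs_of_pos (by norm_num : (0 : ℝ) < 1 / 2)]
    have := mul_le_mul (cF_abs hy0 hy1) e (abs_nonneg _) (by norm_num)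
    linarith
  have h2 : |cH L y * (a * c)| ≤ 9 / 2 * (cV L y * a ^ 2) + 1 / 2 * c ^ 2 := by
    have e := mul_le_mul_of_nonneg_right (cH_sq (L := L) hy0 hy1) (sq_nonneg a)
    rw [abs_le]; constructor <;>
      nlinarith [sq_nonneg (cH L y * a - c), sq_nonneg (cH L y * a + c)]
  have h3 : |1 / 2 * cH1 L y * a ^ 2| ≤ 3 * (cV L y * a ^ 2) := by
    rw [mul_assoc, abs_mul, abs_mul, abs_of_pos (by norm_num : (0 : ℝ) < 1 / 2),
      abs_of_nonneg (sq_nonneg a)]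
    have := mul_le_mul_of_nonneg_right (cH1_abs (L := L) hy0 hy1) (sq_nonneg a)
    linarith
  rw [abs_le] at *
  constructor <;> nlinarith [sq_nonneg b, sq_nonneg c]

theorem brack3 {L y : ℝ} (hy0 : 0 < y) (hy1 : y < 1) (a g : ℝ) : |1 / 2 * cF y * (g ^ 2 - cV L y * a ^ 2)
    + cH L y * (a * g) - 1 / 2 * cH1 L y * a ^ 2| ≤
    4 * g ^ 2 + 11 * (cV L y * a ^ 2) := by
  have hV := cV_nonneg L y hy0 hy1
  have hVa : 0 ≤ cV L y * a ^ 2 := by positivity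
  have h1 : |1 / 2 * cF y * (g ^ 2 - cV L y * a ^ 2)| ≤
      7 / 2 * (g ^ 2 + cV L y * a ^ 2) := by
    have e : |g ^ 2 - cV L y * a ^ 2| ≤ g ^ 2 + cV L y * a ^ 2 := by
      rw [abs_le]; constructor <;> nlinarith [sq_nonneg g]
    rw [mul_assoc, abs_mul, abs_mul, abs_of_pos (by norm_num : (0 : ℝ) < 1 / 2)]
    have := mul_le_mul (cF_abs hy0 hy1) e (abs_nonneg _) (by norm_num)
    linarith
  have h2 : |cH L y * (a * g)| ≤ 9 / 2 * (cV L y * a ^ 2) + 1 / 2 * g ^ 2 := by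
    have e := mul_le_mul_of_nonneg_right (cH_sq (L := L) hy0 hy1) (sq_nonneg a)
    rw [abs_le]; constructor <;>
      nlinarith [sq_nonneg (cH L y * a - g), sq_nonneg (cH L y * a + g)]
  have h3 : |1 / 2 * cH1 L y * a ^ 2| ≤ 3 * (cV L y * a ^ 2) := by
    rw [mul_assoc, abs_mul, abs_mul, abs_of_pos (by norm_num : (0 : ℝ) < 1 / 2),
      abs_of_nonneg (sq_nonneg a)]
    have := mul_le_mul_of_nonneg_right (cH1_abs (L := L) hy0 hy1) (sq_nonneg a)
    linarith
  rw [abs_le] at *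
  constructor <;> nlinarith

theorem eM_abs {L y : ℝ} (hy0 : 0 < y) (hy1 : y < 1) (t s a b c : ℝ) (ht : 0 < t) : |eM L t s y a b c| ≤ 18 * eN L t s y a b c := by
  have h1 := (tau_le_cub t s ht).trans (cub_le_p t s ht)
  have h2 := (tau_le_cub t s ht).trans (cub_le_q t s ht)
  have h3 := min_eN L t s y a b c _ 2 hy0 hy1 h1 h2
  have h4 := mul_le_mul_of_nonneg_left (brack1 (L := L) hy0 hy1 a b c) (tau_nonneg t s)
  unfold eM
  rw [abs_mul, abs_of_nonneg (tau_nonneg t s)]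
  linarith

theorem eErr_abs {L y : ℝ} (hy0 : 0 < y) (hy1 : y < 1) (t s a b c : ℝ) (ht : 0 < t) :
    t * |eErr L t s y a b c| ≤ 896 * eN L t s y a b c := by
  have a1 := (tauT_le_cub t s ht).trans (mul_le_mul_of_nonneg_left (cub_le_p t s ht) (by norm_num))
  have a2 := (tauT_le_cub t s ht).trans (mul_le_mul_of_nonneg_left (cub_le_q t s ht) (by norm_num))
  have b1 := (tauS_le_cub t s ht).trans (mul_le_mul_of_nonneg_left (cub_le_p t s ht) (by norm_num))
  have b2 := (tauS_le_cub t s ht).trans (mul_le_mul_of_nonneg_left (cub_le_q t s ht) (by norm_num))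
  have hT := min_eN L t s y a b c _ 28 hy0 hy1 (by linarith) (a2.trans (by linarith))
  have hS := min_eN L t s y a b c _ 28 hy0 hy1 (by linarith) (b2.trans (by linarith))
  have h4 := mul_le_mul_of_nonneg_left (brack1 (L := L) hy0 hy1 a b c)
    (mul_nonneg ht.le (abs_nonneg (tauT t s)))
  have h5 := mul_le_mul_of_nonneg_left (brack2 (L := L) hy0 hy1 a b c)
    (mul_nonneg ht.le (abs_nonneg (tauS t s)))
  have hN := eN_nonneg L t s y a b c hy0 hy1
  unfold eErr
  refine (mul_le_mul_of_nonneg_left (abs_add_le _ _) ht.le).trans ?_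
  rw [abs_mul, abs_mul, mul_add, ← mul_assoc t, ← mul_assoc t]
  linarith

theorem eP_ge {L y : ℝ} (hy0 : 0 < y) (hy1 : y < 1) (ε t s a b c : ℝ) (ht : 0 < t) (h0 : 0 ≤ ε) (h1 : ε ≤ 1 / 100) :
    1 / 2 * eN L t s y a b c ≤ eP ε L t s y a b c := by
  have h := (abs_le.1 (eM_abs (L := L) hy0 hy1 t s a b c ht)).1
  have hN := eN_nonneg L t s y a b c hy0 hy1
  unfold eP
  nlinarith

theorem eP_le {L y : ℝ} (hy0 : 0 < y) (hy1 : y < 1) (ε t s a b c : ℝ) (ht : 0 < t) (h0 : 0 ≤ ε) (h1 : ε ≤ 1 / 100) :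
    eP ε L t s y a b c ≤ 2 * eN L t s y a b c := by
  have h := (abs_le.1 (eM_abs (L := L) hy0 hy1 t s a b c ht)).2
  have hN := eN_nonneg L t s y a b c hy0 hy1
  unfold eP
  nlinarith

theorem eQ_le_eP {L y : ℝ} (hy0 : 0 < y) (hy1 : y < 1) (ε t s a b c : ℝ) (ht : 0 < t) (h0 : 0 ≤ ε) (h1 : ε ≤ 1 / 100) :
    eQ ε L t s y a b c ≤ eP ε L t s y a b c := by
  have e : eP ε L t s y a b c - eQ ε L t s y a b c
    = 1 / 2 * ((t + s) ^ 2 * (b + c) ^ 2) + 1 / 2 * ((t - s) ^ 2 * (cV L y * a ^ 2))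
      + ε * (tau t s * (1 / 2 * cF y * ((b + c) ^ 2 - cV L y * a ^ 2)
    + cH L y * (a * (b + c)) - 1 / 2 * cH1 L y * a ^ 2)) := by
    unfold eP eQ eN eM; ring
  have hp := (tau_le_cub t s ht).trans (cub_le_p t s ht)
  have hq := (tau_le_cub t s ht).trans (cub_le_q t s ht)
  have hVa : 0 ≤ cV L y * a ^ 2 := mul_nonneg (cV_nonneg L y hy0 hy1) (sq_nonneg a)
  have h4 := mul_le_mul_of_nonneg_left (abs_le.1 (brack3 (L := L) hy0 hy1 a (b + c))).1
    (tau_nonneg t s)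
  have h5 := mul_le_mul_of_nonneg_right hp (sq_nonneg (b + c))
  have h6 := mul_le_mul_of_nonneg_right hq hVa
  set g := (b + c) ^ 2
  set v := cV L y * a ^ 2
  have h7 : -(8 * ((t + s) ^ 2 * g) + 22 * ((t - s) ^ 2 * v)) ≤
      tau t s * (1 / 2 * cF y * (g - v) + cH L y * (a * (b + c)) - 1 / 2 * cH1 L y * a ^ 2) := by
    nlinarith
  have h8 := mul_le_mul_of_nonneg_left h7 h0
  have g1 : 0 ≤ (t + s) ^ 2 * g := by positivity
  have g2 : 0 ≤ (t - s) ^ 2 * v := by positivity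
  nlinarith

theorem cZ_ge {y : ℝ} (hy0 : 0 < y) (hy1 : y < 1) : 1 / 5 ≤ cZ y := by
  unfold cZ
  nlinarith [mul_pos hy0 (sub_pos.2 hy1), sq_nonneg (y - 1 / 2), sq_nonneg (y - 6 / 11),
    mul_nonneg hy0.le (sq_nonneg (y - 1 / 2)), mul_nonneg hy0.le (sq_nonneg (y - 6 / 11)),
    mul_nonneg hy0.le (sq_nonneg (y - 3 / 5)), sq_nonneg (y ^ 2 - 1 / 4), sq_nonneg (y ^ 2),
    mul_nonneg (mul_nonneg hy0.le (sub_pos.2 hy1).le) (sq_nonneg (y - 1 / 2)),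
    mul_nonneg (sq_nonneg y) (sub_pos.2 hy1).le]

/-- lower bound of the bulk -/
def eB (L y a b c : ℝ) : ℝ := y * (1 - y ^ 2) ^ 2 / (2 * L) * (b ^ 2 + c ^ 2)
  + y ^ 2 * (1 - y ^ 2) ^ 4 / (5 * L ^ 3) * a ^ 2

theorem eB_le {L y : ℝ} (hL : 0 < L) (hy0 : 0 < y) (hy1 : y < 1) (a b c : ℝ) :
    eB L y a b c ≤ eBulk L y a b c := by
  have hx : 0 ≤ 1 - y ^ 2 := by nlinarith
  have h := cZ_ge hy0 hy1
  unfold eB eBulk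
  have e1 : y * (1 - y ^ 2) ^ 2 / (2 * L) * (b ^ 2 + c ^ 2)
    = y * (1 - y ^ 2) ^ 2 / L * (1 / 2) * b ^ 2 + y * (1 - y ^ 2) ^ 2 / L * (1 / 2) * c ^ 2 := by
    ring
  have e2 : y ^ 2 * (1 - y ^ 2) ^ 4 / (5 * L ^ 3) = y ^ 2 * (1 - y ^ 2) ^ 4 * (1 / 5) / L ^ 3 := by
    ring
  rw [e1, e2]
  have k1 : (1 : ℝ) / 2 ≤ 2 * y + 1 / 2 := by linarith
  have k2 : (1 : ℝ) / 2 ≤ 8 * y + 1 / 2 := by linarith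
  gcongr

theorem eB_nonneg {L y : ℝ} (hL : 0 < L) (hy0 : 0 < y) (hy1 : y < 1) (a b c : ℝ) :
    0 ≤ eB L y a b c := by
  have hx : 0 ≤ 1 - y ^ 2 := by nlinarith
  unfold eB; positivity

/-- the bracket `2 - (s x / L)(3 - 4x)` -/
def brk (L s y : ℝ) : ℝ := 2 - s * (1 - y ^ 2) / L * (3 - 4 * (1 - y ^ 2))

theorem W_eq (L s y : ℝ) : 2 * cV L y + s * cV1 L y = cV L y * brk L s y := by
  unfold cV cV1 brk; ring

theorem tau_int (t s : ℝ) (ht : 0 < t) (hs : s ^ 2 ≤ t ^ 2 / 4) :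
    4 / 25 * t ^ 2 ≤ tau t s := by
  unfold tau
  rw [le_div_iff₀ (by positivity)]
  have h1 : (t ^ 2 + s ^ 2) ^ 3 ≤ (5 / 4 * t ^ 2) ^ 3 := by gcongr; linarith
  have h2 : (3 / 4 * t ^ 2) ^ 4 ≤ (t ^ 2 - s ^ 2) ^ 4 := by
    apply pow_le_pow_left₀ (by positivity); linarith
  have h3 : 0 < t ^ 8 := by positivity
  have h4 := mul_le_mul_of_nonneg_left h1 (by positivity : 0 ≤ 4 / 25 * t ^ 2)
  nlinarith

theorem claim1 {M : ℝ} {r : ℝ → ℝ} (hM : 0 < M) (hr : IsTortoise M r) (ε : ℝ) (hε : 0 < ε) :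
    ∃ C0 : ℝ, 0 < C0 ∧ ∀ t s a : ℝ, 1 ≤ t →
      t * (2 * cV (2 * M) (yS M r s) + s * cV1 (2 * M) (yS M r s)) * a ^ 2 ≤
        C0 / (2 * t ^ 2) * (1 / 2 * (t ^ 2 + s ^ 2) * (cV (2 * M) (yS M r s) * a ^ 2))
        + 1 / 2 * ε * (tau t s * (yS M r s ^ 2 * (1 - yS M r s ^ 2) ^ 4 / (5 * (2 * M) ^ 3)
          * a ^ 2)) := by
  set T0 : ℝ := 102 * M + 270000 * M / ε with hT0
  have hT0p : 0 < T0 := by positivity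
  refine ⟨320 * T0, by positivity, ?_⟩
  intro t s a ht
  have ht0 : 0 < t := by linarith
  have hy0 := y_pos hM hr s
  have hy1 := y_lt hM hr s
  set y := yS M r s with hy
  have hx0 : 0 < 1 - y ^ 2 := by nlinarith
  have hx1 : 1 - y ^ 2 ≤ 1 := by nlinarith
  have hV := cV_nonneg (2 * M) y hy0 hy1
  have hτ := tau_nonneg t s
  have hVa : 0 ≤ cV (2 * M) y * a ^ 2 := by positivity
  rw [W_eq]
  have hA : 0 ≤ 320 * T0 / (2 * t ^ 2) * (1 / 2 * (t ^ 2 + s ^ 2) * (cV (2 * M) y * a ^ 2)) := by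
    positivity
  have hB : 0 ≤ 1 / 2 * ε * (tau t s * (y ^ 2 * (1 - y ^ 2) ^ 4 / (5 * (2 * M) ^ 3) * a ^ 2)) := by
    positivity
  by_cases hb : brk (2 * M) s y ≤ 0
  · have : t * (cV (2 * M) y * brk (2 * M) s y) * a ^ 2 = t * (cV (2 * M) y * a ^ 2)
      * brk (2 * M) s y := by ring
    rw [this]
    have := mul_nonpos_of_nonneg_of_nonpos (mul_nonneg ht0.le hVa) hb
    linarith
  push Not at hb
  obtain ⟨hs, hx⟩ := stat_bad hM hr s hb
  rw [← hy] at hx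
  have hbm : brk (2 * M) s y ≤ 80 := by
    unfold brk
    have h1 : |s * (1 - y ^ 2) / (2 * M) * (3 - 4 * (1 - y ^ 2))| ≤ 78 := by
      rw [abs_mul, abs_div, abs_mul, abs_of_pos hx0, abs_of_pos (by positivity : 0 < 2 * M)]
      have k1 : |3 - 4 * (1 - y ^ 2)| ≤ 3 := by rw [abs_le]; constructor <;> linarith
      have k2 : |s| * (1 - y ^ 2) / (2 * M) ≤ 26 := by
        rw [div_le_iff₀ (by positivity)]
        nlinarith [abs_nonneg s]
      have k3 := mul_le_mul k2 k1 (abs_nonneg _) (by norm_num)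
      linarith
    have := (abs_le.1 h1).1
    linarith
  have hm : t * (cV (2 * M) y * brk (2 * M) s y) * a ^ 2 ≤ 80 * t * (cV (2 * M) y * a ^ 2) := by
    have := mul_le_mul_of_nonneg_left hbm (mul_nonneg ht0.le hVa)
    linarith
  by_cases htT : t ≤ T0
  · have k : 80 * t ≤ 320 * T0 / (2 * t ^ 2) * (1 / 2 * (t ^ 2 + s ^ 2)) := by
      have : 320 * T0 / (2 * t ^ 2) * (1 / 2 * t ^ 2) = 80 * T0 := by field_simp; ring
      have h2 : 320 * T0 / (2 * t ^ 2) * (1 / 2 * t ^ 2) ≤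
        320 * T0 / (2 * t ^ 2) * (1 / 2 * (t ^ 2 + s ^ 2)) := by
        gcongr; nlinarith [sq_nonneg s]
      linarith
    have := mul_le_mul_of_nonneg_right k hVa
    linarith
  · push Not at htT
    have h1 : 102 * M ≤ t := by
      have : 0 < 270000 * M / ε := by positivity
      linarith
    have h2 : 270000 * M ≤ t * ε := by
      have : 270000 * M / ε ≤ t := by nlinarith
      rwa [div_le_iff₀ hε] at this
    have hs2 : s ^ 2 ≤ t ^ 2 / 4 := by
      have : |s| ≤ t / 2 := by linarith
      have := pow_le_pow_left₀ (abs_nonneg s) this 2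
      rw [sq_abs] at this; linarith
    have hτ2 := tau_int t s ht0 hs2
    have e : y ^ 2 * (1 - y ^ 2) ^ 4 / (5 * (2 * M) ^ 3) * a ^ 2
      = (cV (2 * M) y * a ^ 2) * ((1 - y ^ 2) / (10 * M)) := by
      unfold cV; field_simp; ring
    have k : 80 * t ≤ 1 / 2 * ε * (tau t s * ((1 - y ^ 2) / (10 * M))) := by
      have k1 : 1 / (270 * M) ≤ (1 - y ^ 2) / (10 * M) := by
        rw [div_le_div_iff₀ (by positivity) (by positivity)]; nlinarith
      have k2 : 4 / 25 * t ^ 2 * (1 / (270 * M)) ≤ tau t s * ((1 - y ^ 2) / (10 * M)) :=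
        mul_le_mul hτ2 k1 (by positivity) hτ
      have k3 : 80 * t ≤ 1 / 2 * ε * (4 / 25 * t ^ 2 * (1 / (270 * M))) := by
        have : 1 / 2 * ε * (4 / 25 * t ^ 2 * (1 / (270 * M))) = (2 / 25 * t * (t * ε)) / (270 * M) :=
          by field_simp; ring
        rw [this, le_div_iff₀ (by positivity)]
        nlinarith
      have := mul_le_mul_of_nonneg_left k2 (by positivity : 0 ≤ 1 / 2 * ε)
      linarith
    rw [e]
    have := mul_le_mul_of_nonneg_right k hVa
    linarith

/-- Interior part of the source estimate. -/
theorem src_int {L y : ℝ} (hL : 0 < L) (hy0 : 0 < y) (hy1 : y < 1) (ε A β α a b c : ℝ)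
    (hε : 0 < ε) (hA : y * β ^ 2 ≤ A) :
    15 * |cV L y * β * α| * (|b| + |c|) + ε * |cV L y * β * α| * (cH L y * |a|) ≤
      1 / 2 * ε * eB L y a b c
        + (450 / ε + 45 / 2 * ε) * A / L ^ 3 * (y ^ 2 * (1 - y ^ 2) ^ 4 * α ^ 2) := by
  have hx0 : 0 < 1 - y ^ 2 := by nlinarith
  have hx1 : 1 - y ^ 2 ≤ 1 := by nlinarith
  have hH : 0 ≤ cH L y := by unfold cH; positivity
  set k := ε * y * (1 - y ^ 2) ^ 2 / (4 * L) with hk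
  have hkp : 0 < k := by positivity
  have hA0 : 0 ≤ A := le_trans (by positivity) hA
  set x := 1 - y ^ 2 with hxd
  have gen : ∀ z : ℝ, 15 * |cV L y * β * α| * |z| ≤ k * z ^ 2
      + 225 / ε * A / L ^ 3 * (y ^ 2 * x ^ 4 * α ^ 2) := by
    intro z
    have h := amgm z (15 * (cV L y * β * α)) k hkp
    have e1 : |z * (15 * (cV L y * β * α))| = 15 * |cV L y * β * α| * |z| := by
      rw [abs_mul, abs_mul]; norm_num; ring
    have e2 : (15 * (cV L y * β * α)) ^ 2 / (4 * k)
        = 225 / ε / L ^ 3 * (y ^ 2 * x ^ 4 * α ^ 2) * (y * β ^ 2) := by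
      rw [hk]; unfold cV; rw [← hxd]; field_simp; ring
    rw [e1, e2] at h
    have := mul_le_mul_of_nonneg_left hA
      (by positivity : 0 ≤ 225 / ε / L ^ 3 * (y ^ 2 * x ^ 4 * α ^ 2))
    have e3 : 225 / ε * A / L ^ 3 * (y ^ 2 * x ^ 4 * α ^ 2) =
      225 / ε / L ^ 3 * (y ^ 2 * x ^ 4 * α ^ 2) * A := by ring
    rw [e3]; linarith
  have hHt : |cV L y * β * α| * (cH L y * |a|) ≤ y ^ 2 * x ^ 4 / (10 * L ^ 3) * a ^ 2
      + 45 / 2 * A / L ^ 3 * (y ^ 2 * x ^ 4 * α ^ 2) := by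
    have h := amgm a (cH L y * (cV L y * β * α)) (y ^ 2 * x ^ 4 / (10 * L ^ 3)) (by positivity)
    have e1 : |a * (cH L y * (cV L y * β * α))| = |cV L y * β * α| * (cH L y * |a|) := by
      rw [abs_mul, abs_mul (cH L y), abs_of_nonneg hH]; ring
    have e2 : (cH L y * (cV L y * β * α)) ^ 2 / (4 * (y ^ 2 * x ^ 4 / (10 * L ^ 3)))
        = 45 / 2 / L ^ 3 * (y ^ 2 * x ^ 4 * α ^ 2) * (y ^ 3 * x ^ 2) * (y * β ^ 2) := by
      unfold cV cH; rw [← hxd]; field_simp; ring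
    rw [e1, e2] at h
    have h3 : (y ^ 3 * x ^ 2) * (y * β ^ 2) ≤ 1 * A := by
      apply mul_le_mul _ hA (by positivity) (by norm_num)
      have : y ^ 3 ≤ 1 := pow_le_one₀ hy0.le hy1.le
      have : x ^ 2 ≤ 1 := pow_le_one₀ hx0.le hx1
      have : 0 < y ^ 3 := by positivity
      nlinarith
    have := mul_le_mul_of_nonneg_left h3
      (by positivity : 0 ≤ 45 / 2 / L ^ 3 * (y ^ 2 * x ^ 4 * α ^ 2))
    have e3 : 45 / 2 * A / L ^ 3 * (y ^ 2 * x ^ 4 * α ^ 2) =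
      45 / 2 / L ^ 3 * (y ^ 2 * x ^ 4 * α ^ 2) * (1 * A) := by ring
    rw [e3]
    linarith
  have hb := gen b
  have hc := gen c
  have hHt' := mul_le_mul_of_nonneg_left hHt hε.le
  have e : 1 / 2 * ε * eB L y a b c = k * b ^ 2 + k * c ^ 2
      + ε * (y ^ 2 * x ^ 4 / (10 * L ^ 3) * a ^ 2) := by
    rw [hk]; unfold eB; rw [← hxd]; ring
  rw [e]
  have e4 : (450 / ε + 45 / 2 * ε) * A / L ^ 3 * (y ^ 2 * x ^ 4 * α ^ 2)
    = 225 / ε * A / L ^ 3 * (y ^ 2 * x ^ 4 * α ^ 2) + 225 / ε * A / L ^ 3 * (y ^ 2 * x ^ 4 * α ^ 2)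
      + ε * (45 / 2 * A / L ^ 3 * (y ^ 2 * x ^ 4 * α ^ 2)) := by ring
  rw [e4]
  linarith

theorem brk_abs {L s y : ℝ} (hL : 0 < L) (hy0 : 0 < y) (hy1 : y < 1) :
    |brk L s y| ≤ (2 + 3 / L) * (1 + |s| * (1 - y ^ 2)) := by
  have hx0 : 0 < 1 - y ^ 2 := by nlinarith
  have hx1 : 1 - y ^ 2 ≤ 1 := by nlinarith
  unfold brk
  have k1 : |3 - 4 * (1 - y ^ 2)| ≤ 3 := by rw [abs_le]; constructor <;> linarith
  have h1 : |s * (1 - y ^ 2) / L * (3 - 4 * (1 - y ^ 2))| ≤ |s| * (1 - y ^ 2) / L * 3 := by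
    rw [abs_mul, abs_div, abs_mul, abs_of_pos hx0, abs_of_pos hL]
    gcongr
  have h2 := abs_sub 2 (s * (1 - y ^ 2) / L * (3 - 4 * (1 - y ^ 2)))
  have h3 : |(2 : ℝ)| = 2 := by norm_num
  have h4 : 0 ≤ |s| * (1 - y ^ 2) := by positivity
  have h5 : 0 < 3 / L := by positivity
  have h6 : |s| * (1 - y ^ 2) / L * 3 = 3 / L * (|s| * (1 - y ^ 2)) := by ring
  nlinarith

/-- constants for the source term -/
theorem src_const {M : ℝ} {r : ℝ → ℝ} (hM : 0 < M) (hr : IsTortoise M r) :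
    ∃ A : ℝ, 0 < A ∧ ∀ s, yS M r s * brk (2 * M) s (yS M r s) ^ 2 ≤ A ∧
      s ^ 2 * cV (2 * M) (yS M r s) * brk (2 * M) s (yS M r s) ^ 2 ≤ A := by
  obtain ⟨U, hU, hs⟩ := stat_U hM hr
  refine ⟨(2 + 3 / (2 * M)) ^ 2 * U + (2 + 3 / (2 * M)) ^ 2 * U / (2 * M) ^ 2, by positivity, ?_⟩
  intro s
  have hy0 := y_pos hM hr s
  have hy1 := y_lt hM hr s
  have h := hs s
  set y := yS M r s
  have hx0 : 0 < 1 - y ^ 2 := by nlinarith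
  have hx1 : 1 - y ^ 2 ≤ 1 := by nlinarith
  have hb := brk_abs (s := s) (by positivity : 0 < 2 * M) hy0 hy1
  set z := 1 + |s| * (1 - y ^ 2) with hz
  have hsx : 0 ≤ |s| * (1 - y ^ 2) := by positivity
  have hz1 : 1 ≤ z := by linarith
  have hb2 : brk (2 * M) s y ^ 2 ≤ (2 + 3 / (2 * M)) ^ 2 * z ^ 2 := by
    rw [← sq_abs, ← mul_pow]; exact pow_le_pow_left₀ (abs_nonneg _) hb 2
  have h24 : z ^ 2 ≤ z ^ 4 := pow_le_pow_right₀ hz1 (by norm_num)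
  have p1 : 0 ≤ (2 + 3 / (2 * M)) ^ 2 * U := by positivity
  have p2 : 0 ≤ (2 + 3 / (2 * M)) ^ 2 * U / (2 * M) ^ 2 := by positivity
  constructor
  · have : y * brk (2 * M) s y ^ 2 ≤ (2 + 3 / (2 * M)) ^ 2 * (y * z ^ 4) := by
      calc _ ≤ y * ((2 + 3 / (2 * M)) ^ 2 * z ^ 4) := by
            gcongr; exact hb2.trans (by gcongr)
        _ = _ := by ring
    have h2 := mul_le_mul_of_nonneg_left h (by positivity : 0 ≤ (2 + 3 / (2 * M)) ^ 2)
    linarith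
  · have e1 : s ^ 2 * (1 - y ^ 2) ^ 2 ≤ z ^ 2 := by
      have : s ^ 2 * (1 - y ^ 2) ^ 2 = (|s| * (1 - y ^ 2)) ^ 2 := by rw [mul_pow, sq_abs]
      rw [this]; gcongr; linarith
    have e2 : s ^ 2 * cV (2 * M) y ≤ y * z ^ 2 / (2 * M) ^ 2 := by
      have : s ^ 2 * cV (2 * M) y = (s ^ 2 * (1 - y ^ 2) ^ 2) * (y ^ 2 * (1 - y ^ 2)) / (2 * M) ^ 2 := by
        unfold cV; ring
      rw [this]
      have : y ^ 2 * (1 - y ^ 2) ≤ y := by nlinarith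
      have := mul_le_mul e1 this (by positivity) (by positivity)
      exact div_le_div_of_nonneg_right (by linarith) (by positivity)
    have e3 := mul_le_mul e2 hb2 (sq_nonneg _) (by positivity)
    have e4 : y * z ^ 2 / (2 * M) ^ 2 * ((2 + 3 / (2 * M)) ^ 2 * z ^ 2)
      = (2 + 3 / (2 * M)) ^ 2 * (y * z ^ 4) / (2 * M) ^ 2 := by ring
    have h2 : (2 + 3 / (2 * M)) ^ 2 * (y * z ^ 4) / (2 * M) ^ 2 ≤
      (2 + 3 / (2 * M)) ^ 2 * U / (2 * M) ^ 2 := by gcongr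
    linarith

theorem src_ext (δ t p q W g h : ℝ) (hδ : 0 < δ) (ht : 0 < t) :
    |W| * |1 / 2 * (p ^ 2 * g + q ^ 2 * h)| ≤
      δ / (4 * t) * (1 / 4 * (q ^ 2 * h ^ 2) + 1 / 4 * (p ^ 2 * g ^ 2))
        + t / δ * W ^ 2 * (p ^ 2 + q ^ 2) := by
  have k0 : 0 < δ / (16 * t) := by positivity
  have h1 := mul_le_mul_of_nonneg_left (amgm g (1 / 2 * W) _ k0) (sq_nonneg p)
  have h2 := mul_le_mul_of_nonneg_left (amgm h (1 / 2 * W) _ k0) (sq_nonneg q)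
  have e1 : (1 / 2 * W) ^ 2 / (4 * (δ / (16 * t))) = t / δ * W ^ 2 := by field_simp; ring
  rw [e1] at h1 h2
  have e2 : |W| * |1 / 2 * (p ^ 2 * g + q ^ 2 * h)| = |p ^ 2 * (g * (1 / 2 * W))
    + q ^ 2 * (h * (1 / 2 * W))| := by rw [← abs_mul]; congr 1; ring
  have e3 := abs_add_le (p ^ 2 * (g * (1 / 2 * W))) (q ^ 2 * (h * (1 / 2 * W)))
  rw [abs_mul, abs_mul (q ^ 2), abs_of_nonneg (sq_nonneg p), abs_of_nonneg (sq_nonneg q)] at e3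
  rw [e2]
  have e4 : δ / (4 * t) * (1 / 4 * (q ^ 2 * h ^ 2) + 1 / 4 * (p ^ 2 * g ^ 2))
    = p ^ 2 * (δ / (16 * t) * g ^ 2) + q ^ 2 * (δ / (16 * t) * h ^ 2) := by field_simp; ring
  rw [e4]
  linarith

set_option maxHeartbeats 1000000 in
theorem claim2 {M : ℝ} {r : ℝ → ℝ} (hM : 0 < M) (hr : IsTortoise M r) (ε δ : ℝ) (hε : 0 < ε)
    (hε1 : ε ≤ 1) (hδ : 0 < δ) :
    ∃ B : ℝ, 0 < B ∧ ∀ t s α β γ a b c : ℝ, 1 ≤ t →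
      (-(2 * cV (2 * M) (yS M r s) + s * cV1 (2 * M) (yS M r s)) * α)
        * ((t ^ 2 + s ^ 2) * b + 2 * t * s * c + ε * tau t s
          * (cF (yS M r s) * c + cH (2 * M) (yS M r s) * a)) ≤
      δ / (4 * t) * eN (2 * M) t s (yS M r s) a b c
        + 1 / 2 * ε * (tau t s * eB (2 * M) (yS M r s) a b c)
        + B * (δ / (4 * t) * eN (2 * M) t s (yS M r s) α β γ
        + 1 / 2 * ε * (tau t s * eB (2 * M) (yS M r s) α β γ)) := by
  obtain ⟨A, hA, hAs⟩ := src_const hM hr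
  set B1 : ℝ := 10 * (450 / ε + 45 / 2 * ε) * A / ε with hB1
  set B2 : ℝ := 64 * A / δ ^ 2 with hB2
  have hB1p : 0 < B1 := by positivity
  have hB2p : 0 < B2 := by positivity
  refine ⟨B1 + B2, by positivity, ?_⟩
  intro t s α β γ a b c ht
  have ht0 : 0 < t := by linarith
  have hL : 0 < 2 * M := by positivity
  have hy0 := y_pos hM hr s
  have hy1 := y_lt hM hr s
  obtain ⟨hA1, hA2⟩ := hAs s
  set y := yS M r s with hy
  have hx0 : 0 < 1 - y ^ 2 := by nlinarith
  set L := 2 * M with hLd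
  have hV := cV_nonneg L y hy0 hy1
  have hτ := tau_nonneg t s
  have hH : 0 ≤ cH L y := by unfold cH; positivity
  rw [W_eq]
  set κ := brk L s y with hκ
  have hsrc := src_int hL hy0 hy1 ε A κ α a b c hε hA1
  set w := |cV L y * κ * α| with hw
  have hw0 : 0 ≤ w := abs_nonneg _
  have hNX := eN_nonneg L t s y a b c hy0 hy1
  have hNχ := eN_nonneg L t s y α β γ hy0 hy1
  have hBX := eB_nonneg hL hy0 hy1 a b c
  have hBχ := eB_nonneg hL hy0 hy1 α β γ
  -- bound of the small term
  have hFc : |cF y * c + cH L y * a| ≤ 7 * |c| + cH L y * |a| := by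
    refine (abs_add_le _ _).trans ?_
    rw [abs_mul, abs_mul, abs_of_nonneg hH]
    have := mul_le_mul_of_nonneg_right (cF_abs hy0 hy1) (abs_nonneg c)
    linarith
  have hχ : (450 / ε + 45 / 2 * ε) * A / L ^ 3 * (y ^ 2 * (1 - y ^ 2) ^ 4 * α ^ 2)
      ≤ B1 * (1 / 2 * ε * eB L y α β γ) := by
    have e : (450 / ε + 45 / 2 * ε) * A / L ^ 3 * (y ^ 2 * (1 - y ^ 2) ^ 4 * α ^ 2)
      = B1 * (1 / 2 * ε * (y ^ 2 * (1 - y ^ 2) ^ 4 / (5 * L ^ 3) * α ^ 2)) := by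
      rw [hB1]; field_simp; ring
    rw [e]
    unfold eB
    have : 0 ≤ y * (1 - y ^ 2) ^ 2 / (2 * L) * (β ^ 2 + γ ^ 2) := by positivity
    gcongr
    linarith
  have htot : (-(cV L y * κ) * α) * ((t ^ 2 + s ^ 2) * b + 2 * t * s * c + ε * tau t s
          * (cF y * c + cH L y * a)) ≤ w * |(t ^ 2 + s ^ 2) * b + 2 * t * s * c|
      + tau t s * (ε * w * (7 * |c| + cH L y * |a|)) := by
    refine (le_abs_self _).trans ?_
    rw [abs_mul]
    have e : |-(cV L y * κ) * α| = w := by rw [hw, neg_mul, abs_neg]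
    rw [e]
    have h1 := abs_add_le ((t ^ 2 + s ^ 2) * b + 2 * t * s * c)
      (ε * tau t s * (cF y * c + cH L y * a))
    rw [abs_mul (ε * tau t s), abs_of_nonneg (by positivity : 0 ≤ ε * tau t s)] at h1
    have h2 := mul_le_mul_of_nonneg_left hFc (by positivity : 0 ≤ ε * tau t s)
    have h3 := mul_le_mul_of_nonneg_left (h1.trans (add_le_add_right h2 _)) hw0
    linarith
  have hτint := mul_le_mul_of_nonneg_left (hsrc.trans (add_le_add_right hχ _)) hτ
  have hwc : 0 ≤ w * |c| := by positivity
  have hwb : 0 ≤ w * |b| := by positivity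
  have q1 : 0 ≤ δ / (4 * t) * eN L t s y a b c := by positivity
  have q2 : 0 ≤ B1 * (δ / (4 * t) * eN L t s y α β γ) := by positivity
  have q3 : 0 ≤ B2 * (1 / 2 * ε * (tau t s * eB L y α β γ)) := by positivity
  have q4 : 0 ≤ B2 * (δ / (4 * t) * eN L t s y α β γ) := by positivity
  have hsm : ε * (w * |c|) ≤ w * |c| := mul_le_of_le_one_left hwc hε1
  by_cases hs : s ^ 2 ≤ t ^ 2 / 4
  · have hτ2 := tau_int t s ht0 hs
    have hK : |(t ^ 2 + s ^ 2) * b + 2 * t * s * c| ≤ 8 * tau t s * (|b| + |c|) := by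
      refine (abs_add_le _ _).trans ?_
      rw [abs_mul, abs_mul (2 * t * s), abs_of_nonneg (by positivity : 0 ≤ t ^ 2 + s ^ 2)]
      have h1 : |2 * t * s| ≤ t ^ 2 + s ^ 2 := by
        rw [abs_le]; constructor <;> nlinarith [sq_nonneg (t - s), sq_nonneg (t + s)]
      have h2 : t ^ 2 + s ^ 2 ≤ 8 * tau t s := by nlinarith
      have := mul_le_mul_of_nonneg_right h2 (abs_nonneg b)
      have := mul_le_mul_of_nonneg_right (h1.trans h2) (abs_nonneg c)
      linarith
    have h5 := mul_le_mul_of_nonneg_left hK hw0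
    have h6 := mul_le_mul_of_nonneg_left hsm hτ
    have h7 : 0 ≤ tau t s * (w * |b|) := by positivity
    linarith
  · push Not at hs
    have e : (t ^ 2 + s ^ 2) * b + 2 * t * s * c =
      1 / 2 * ((t + s) ^ 2 * (b + c) + (t - s) ^ 2 * (b - c)) := by ring
    have h1 := src_ext δ t (t + s) (t - s) (cV L y * κ * α) (b + c) (b - c) hδ ht0
    rw [← hw, ← e] at h1
    have h2 : δ / (4 * t) * (1 / 4 * ((t - s) ^ 2 * (b - c) ^ 2)
        + 1 / 4 * ((t + s) ^ 2 * (b + c) ^ 2)) ≤ δ / (4 * t) * eN L t s y a b c := by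
      have : 0 ≤ 1 / 2 * (t ^ 2 + s ^ 2) * (cV L y * a ^ 2) := by positivity
      rw [eN_eq]; exact mul_le_mul_of_nonneg_left (by linarith) (by positivity)
    have h3 : t / δ * (cV L y * κ * α) ^ 2 * ((t + s) ^ 2 + (t - s) ^ 2) ≤
        B2 * (δ / (4 * t) * eN L t s y α β γ) := by
      have k1 : t ^ 2 * cV L y * κ ^ 2 ≤ 4 * A := by
        have : 0 ≤ cV L y * κ ^ 2 := by positivity
        nlinarith
      have k2 : 1 / 2 * (t ^ 2 + s ^ 2) * (cV L y * α ^ 2) ≤ eN L t s y α β γ := by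
        rw [eN_eq]
        have : 0 ≤ 1 / 4 * ((t - s) ^ 2 * (β - γ) ^ 2) := by positivity
        have : 0 ≤ 1 / 4 * ((t + s) ^ 2 * (β + γ) ^ 2) := by positivity
        linarith
      have k3 := mul_le_mul_of_nonneg_left k2 (by positivity : 0 ≤ B2 * (δ / (4 * t)))
      have k4 : t / δ * (cV L y * κ * α) ^ 2 * ((t + s) ^ 2 + (t - s) ^ 2)
        = (2 / (δ * t) * ((t ^ 2 + s ^ 2) * (cV L y * α ^ 2))) * (t ^ 2 * cV L y * κ ^ 2) := by
        field_simp; ring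
      have k5 : B2 * (δ / (4 * t)) * (1 / 2 * (t ^ 2 + s ^ 2) * (cV L y * α ^ 2))
        = (2 / (δ * t) * ((t ^ 2 + s ^ 2) * (cV L y * α ^ 2))) * (4 * A) := by
        rw [hB2]; field_simp; ring
      have k6 := mul_le_mul_of_nonneg_left k1
        (by positivity : 0 ≤ 2 / (δ * t) * ((t ^ 2 + s ^ 2) * (cV L y * α ^ 2)))
      linarith
    have h6 := mul_le_mul_of_nonneg_left hsm hτ
    have h7 : 0 ≤ tau t s * (w * |b|) := by positivity
    have h8 : 0 ≤ tau t s * (w * |c|) := by positivity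
    linarith

/-- master pointwise inequality -/
theorem master {M : ℝ} {r : ℝ → ℝ} (hM : 0 < M) (hr : IsTortoise M r) (δ : ℝ)
    (hδ : 0 < δ) (hδ1 : δ < 1) :
    ∃ C0 B : ℝ, 0 < C0 ∧ 0 < B ∧ ∀ t s α β γ a b c : ℝ, 1 ≤ t →
      -(δ / t + C0 / t ^ 2) * (eP (δ / 4000) (2 * M) t s (yS M r s) a b c
          + B * eP (δ / 4000) (2 * M) t s (yS M r s) α β γ)
      + ((-(2 * cV (2 * M) (yS M r s) + s * cV1 (2 * M) (yS M r s)) * α)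
        * ((t ^ 2 + s ^ 2) * b + 2 * t * s * c + (δ / 4000) * tau t s
          * (cF (yS M r s) * c + cH (2 * M) (yS M r s) * a))
        + t * (2 * cV (2 * M) (yS M r s) + s * cV1 (2 * M) (yS M r s)) * a ^ 2
        - (δ / 4000) * (tau t s * eBulk (2 * M) (yS M r s) a b c)
        + (δ / 4000) * eErr (2 * M) t s (yS M r s) a b c)
      + B * (t * (2 * cV (2 * M) (yS M r s) + s * cV1 (2 * M) (yS M r s)) * α ^ 2
        - (δ / 4000) * (tau t s * eBulk (2 * M) (yS M r s) α β γ)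
        + (δ / 4000) * eErr (2 * M) t s (yS M r s) α β γ) ≤ 0 := by
  have hε : 0 < δ / 4000 := by positivity
  obtain ⟨C0, hC0, h1⟩ := claim1 hM hr (δ / 4000) hε
  obtain ⟨B, hB, h2⟩ := claim2 hM hr (δ / 4000) δ hε (by linarith) hδ
  refine ⟨C0, B, hC0, hB, ?_⟩
  intro t s α β γ a b c ht
  have ht0 : 0 < t := by linarith
  have hL : 0 < 2 * M := by positivity
  have hy0 := y_pos hM hr s
  have hy1 := y_lt hM hr s
  have g2 := h2 t s α β γ a b c ht
  have hτ := tau_nonneg t s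
  have key : ∀ a b c : ℝ, -(δ / t + C0 / t ^ 2) * eP (δ / 4000) (2 * M) t s (yS M r s) a b c
      + (t * (2 * cV (2 * M) (yS M r s) + s * cV1 (2 * M) (yS M r s)) * a ^ 2
        - (δ / 4000) * (tau t s * eBulk (2 * M) (yS M r s) a b c)
        + (δ / 4000) * eErr (2 * M) t s (yS M r s) a b c)
      ≤ - (δ / (4 * t) * eN (2 * M) t s (yS M r s) a b c
        + 1 / 2 * (δ / 4000) * (tau t s * eB (2 * M) (yS M r s) a b c)) := by
    intro a b c
    have k1 := h1 t s a ht
    set y := yS M r s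
    have k2 := mul_le_mul_of_nonneg_left (eP_ge (L := 2 * M) hy0 hy1 (δ / 4000) t s a b c ht0 hε.le
      (by linarith)) (by positivity : 0 ≤ δ / t + C0 / t ^ 2)
    have k3 := eErr_abs (L := 2 * M) hy0 hy1 t s a b c ht0
    have k4 := mul_le_mul_of_nonneg_left (eB_le hL hy0 hy1 a b c)
      (by positivity : 0 ≤ δ / 4000 * tau t s)
    have hN := eN_nonneg (2 * M) t s y a b c hy0 hy1
    have k5 : δ / 4000 * eErr (2 * M) t s y a b c ≤ δ / (4 * t) * eN (2 * M) t s y a b c := by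
      have : eErr (2 * M) t s y a b c ≤ 896 * eN (2 * M) t s y a b c / t := by
        rw [le_div_iff₀ ht0]
        have := le_abs_self (eErr (2 * M) t s y a b c)
        nlinarith
      have h5 := mul_le_mul_of_nonneg_left this hε.le
      have e : δ / (4 * t) * eN (2 * M) t s y a b c - δ / 4000 * (896 * eN (2 * M) t s y a b c / t)
        = δ / t * (104 / 4000) * eN (2 * M) t s y a b c := by field_simp; ring
      have : 0 ≤ δ / t * (104 / 4000) * eN (2 * M) t s y a b c := by positivity
      linarith
    have k6 : 1 / 2 * (t ^ 2 + s ^ 2) * (cV (2 * M) y * a ^ 2) ≤ eN (2 * M) t s y a b c := by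
      rw [eN_eq]
      have : 0 ≤ 1 / 4 * ((t - s) ^ 2 * (b - c) ^ 2) := by positivity
      have : 0 ≤ 1 / 4 * ((t + s) ^ 2 * (b + c) ^ 2) := by positivity
      linarith
    have k7 := mul_le_mul_of_nonneg_left k6 (by positivity : 0 ≤ C0 / (2 * t ^ 2))
    have k8 : y ^ 2 * (1 - y ^ 2) ^ 4 / (5 * (2 * M) ^ 3) * a ^ 2 ≤ eB (2 * M) y a b c := by
      have hx0 : 0 < 1 - y ^ 2 := by nlinarith
      unfold eB
      have : 0 ≤ y * (1 - y ^ 2) ^ 2 / (2 * (2 * M)) * (b ^ 2 + c ^ 2) := by positivity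
      linarith
    have k9 := mul_le_mul_of_nonneg_left k8 (by positivity : 0 ≤ 1 / 2 * (δ / 4000) * tau t s)
    have e1 : (δ / t + C0 / t ^ 2) * (1 / 2 * eN (2 * M) t s y a b c)
      = 2 * (δ / (4 * t) * eN (2 * M) t s y a b c) + C0 / (2 * t ^ 2) * eN (2 * M) t s y a b c := by
      field_simp; ring
    linarith
  have kX := key a b c
  have kχ := mul_le_mul_of_nonneg_left (key α β γ) hB.le
  linarith

theorem Sm.mulS {ξ : ℝ → ℝ → ℝ} {g : ℝ → ℝ} (hg : ContDiff ℝ (⊤ : ℕ∞) g) (h : Sm ξ) :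
    Sm (fun t s => g s * ξ t s) := by
  unfold Sm at *
  have : ContDiff ℝ (⊤ : ℕ∞) (fun p : ℝ × ℝ => g p.2 * Function.uncurry ξ p) :=
    (hg.comp contDiff_snd).mul h
  exact this

theorem Sm.svf {ξ : ℝ → ℝ → ℝ} (h : Sm ξ) : Sm (Svf ξ) := by
  have h1 := h.pdt
  have h2 := h.pds
  unfold Sm at *
  have : ContDiff ℝ (⊤ : ℕ∞) (fun p : ℝ × ℝ => p.1 * Function.uncurry (pd_t ξ) p
      + p.2 * Function.uncurry (pd_s ξ) p) :=
    (contDiff_fst.mul h1).add (contDiff_snd.mul h2)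
  exact this

theorem Sm.svf_t {ξ : ℝ → ℝ → ℝ} (h : Sm ξ) (t s : ℝ) :
    pd_t (Svf ξ) t s = pd_t ξ t s + t * pd_t (pd_t ξ) t s + s * pd_s (pd_t ξ) t s := by
  have := ((hasDerivAt_id t).mul (h.pdt.hasT t s)).add ((h.pds.hasT t s).const_mul s)
  rw [← h.comm]
  have e := this.deriv
  simp only [id, one_mul] at e
  exact e

theorem Sm.svf_s {ξ : ℝ → ℝ → ℝ} (h : Sm ξ) (t s : ℝ) :
    pd_s (Svf ξ) t s = t * pd_s (pd_t ξ) t s + pd_s ξ t s + s * pd_s (pd_s ξ) t s := by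
  have := ((h.pdt.hasS t s).const_mul t).add ((hasDerivAt_id s).mul (h.pds.hasS t s))
  have e := this.deriv
  simp only [id, one_mul] at e
  rw [add_assoc]
  exact e

theorem chi_t (r : ℝ → ℝ) {φ : ℝ → ℝ → ℝ} (h : Sm φ) (t s : ℝ) :
    pd_t (fun t s => r s * φ t s) t s = r s * pd_t φ t s :=
  ((h.hasT t s).const_mul (r s)).deriv

theorem mulS_s {g : ℝ → ℝ} {g' : ℝ} {φ : ℝ → ℝ → ℝ} (h : Sm φ) (t s : ℝ) (hg : HasDerivAt g g' s) :
    pd_s (fun t s => g s * φ t s) t s = g' * φ t s + g s * pd_s φ t s :=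
  (hg.mul (h.hasS t s)).deriv

section W
variable {M : ℝ} {r : ℝ → ℝ}

theorem y_deriv2 (hM : 0 < M) (hr : IsTortoise M r) (s : ℝ) :
    HasDerivAt (yS M r) (yS M r s * (1 - yS M r s ^ 2) ^ 2 / (2 * (2 * M))) s := by
  have := y_deriv hM hr s
  rwa [show 2 * (2 * M) = 4 * M by ring]

theorem y2_deriv (hM : 0 < M) (hr : IsTortoise M r) (s : ℝ) :
    HasDerivAt (fun s => yS M r s ^ 2) (yS M r s ^ 2 * (1 - yS M r s ^ 2) ^ 2 / (2 * M)) s := by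
  refine ((y_deriv hM hr s).fun_pow 2).congr_deriv ?_
  push_cast; field_simp; ring

theorem chi_wave (hM : 0 < M) (hr : IsTortoise M r) {φ : ℝ → ℝ → ℝ} (h : IsWaveSol r φ)
    (t s : ℝ) :
    pd_t (pd_t (fun t s => r s * φ t s)) t s = pd_s (pd_s (fun t s => r s * φ t s)) t s
      - cV (2 * M) (yS M r s) * (r s * φ t s) := by
  have hφ : Sm φ := h.1
  have hw := h.2.1 t s
  have hr0 := r_pos hM hr s
  have hx := r_mul_x hM hr s
  have e1 : pd_t (fun t s => r s * φ t s) = fun t s => r s * pd_t φ t s := by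
    ext t s; exact chi_t r hφ t s
  have e2 : pd_s (fun t s => r s * φ t s) = fun t s => yS M r s ^ 2 * φ t s + r s * pd_s φ t s := by
    ext t s; exact mulS_s hφ t s (r_deriv' hM hr s)
  have d1 : deriv (fun x => r x ^ 2 * pd_s φ t x) s
      = 2 * r s * yS M r s ^ 2 * pd_s φ t s + r s ^ 2 * pd_s (pd_s φ) t s := by
    have := (((r_deriv' hM hr s).fun_pow 2).mul (hφ.pds.hasS t s)).deriv
    refine Eq.trans this ?_
    push_cast; ring
  have d2 : pd_s (fun t s => yS M r s ^ 2 * φ t s + r s * pd_s φ t s) t s =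
      (yS M r s ^ 2 * (1 - yS M r s ^ 2) ^ 2 / (2 * M) * φ t s + yS M r s ^ 2 * pd_s φ t s)
      + (yS M r s ^ 2 * pd_s φ t s + r s * pd_s (pd_s φ) t s) :=
    (((y2_deriv hM hr s).mul (hφ.hasS t s)).add
      ((r_deriv' hM hr s).mul (hφ.pds.hasS t s))).deriv
  rw [e1, chi_t r hφ.pdt, hw, d1, e2, d2]
  set y := yS M r s
  have hV : cV (2 * M) y * (r s * φ t s) = y ^ 2 * (1 - y ^ 2) ^ 2 / (2 * M) * φ t s := by
    have : cV (2 * M) y * (r s * φ t s) = y ^ 2 * (1 - y ^ 2) ^ 2 / (2 * M) ^ 2 * φ t s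
      * (r s * (1 - y ^ 2)) := by unfold cV; ring
    rw [this, hx]; field_simp
  rw [hV]
  field_simp
  ring

theorem X_wave (hM : 0 < M) (hr : IsTortoise M r) {χ : ℝ → ℝ → ℝ} (h : Sm χ)
    (hw : ∀ t s, pd_t (pd_t χ) t s = pd_s (pd_s χ) t s - cV (2 * M) (yS M r s) * χ t s)
    (t s : ℝ) :
    pd_t (pd_t (Svf χ)) t s = pd_s (pd_s (Svf χ)) t s
      - cV (2 * M) (yS M r s) * Svf χ t s
      + (-(2 * cV (2 * M) (yS M r s) + s * cV1 (2 * M) (yS M r s)) * χ t s) := by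
  have hw' : pd_t (pd_t χ) = fun t s => pd_s (pd_s χ) t s - cV (2 * M) (yS M r s) * χ t s := by
    ext t s; exact hw t s
  have et : pd_t (Svf χ) = fun t s => pd_t χ t s + t * pd_t (pd_t χ) t s + s * pd_s (pd_t χ) t s := by
    ext t s; exact h.svf_t t s
  have es : pd_s (Svf χ) = fun t s => t * pd_s (pd_t χ) t s + pd_s χ t s + s * pd_s (pd_s χ) t s := by
    ext t s; exact h.svf_s t s
  have dt : pd_t (fun t s => pd_t χ t s + t * pd_t (pd_t χ) t s + s * pd_s (pd_t χ) t s) t s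
      = pd_t (pd_t χ) t s + (1 * pd_t (pd_t χ) t s + t * pd_t (pd_t (pd_t χ)) t s)
        + s * pd_t (pd_s (pd_t χ)) t s :=
    (((h.pdt.hasT t s).add ((hasDerivAt_id t).mul (h.pdt.pdt.hasT t s))).add
      ((h.pdt.pds.hasT t s).const_mul s)).deriv
  have ds : pd_s (fun t s => t * pd_s (pd_t χ) t s + pd_s χ t s + s * pd_s (pd_s χ) t s) t s
      = t * pd_s (pd_s (pd_t χ)) t s + pd_s (pd_s χ) t s
        + (1 * pd_s (pd_s χ) t s + s * pd_s (pd_s (pd_s χ)) t s) :=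
    (((h.pdt.pds.hasS t s).const_mul t).add (h.pds.hasS t s)).add
      ((hasDerivAt_id s).mul (h.pds.pds.hasS t s)) |>.deriv
  have c1 : pd_t (pd_t (pd_t χ)) t s = pd_t (pd_s (pd_s χ)) t s
      - cV (2 * M) (yS M r s) * pd_t χ t s := by
    rw [hw']
    exact ((h.pds.pds.hasT t s).sub ((h.hasT t s).const_mul _)).deriv
  have c2 : pd_s (pd_t (pd_t χ)) t s = pd_s (pd_s (pd_s χ)) t s
      - (cV1 (2 * M) (yS M r s) * χ t s + cV (2 * M) (yS M r s) * pd_s χ t s) := by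
    rw [hw']
    exact ((h.pds.pds.hasS t s).sub ((cV_deriv (y_deriv2 hM hr s)).mul (h.hasS t s))).deriv
  have c3 : pd_t (pd_s (pd_s χ)) t s = pd_s (pd_s (pd_t χ)) t s := by
    rw [h.pds.comm]
    congr 1
    ext t s; exact h.comm t s
  rw [et, es, dt, ds, h.pdt.comm, c2, c1, c3, hw t s]
  unfold Svf
  ring
end W

theorem eP_cd (ε L : ℝ) (y a b c : ℝ × ℝ → ℝ) (p : ℝ × ℝ) (hp : 0 < p.1)
    (hy : ContDiffAt ℝ 1 y p) (ha : ContDiffAt ℝ 1 a p) (hb : ContDiffAt ℝ 1 b p)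
    (hc : ContDiffAt ℝ 1 c p) :
    ContDiffAt ℝ 1 (fun p => eP ε L p.1 p.2 (y p) (a p) (b p) (c p)) p := by
  have hd : (p.1 ^ 2 + p.2 ^ 2) ^ 3 ≠ 0 := by positivity
  unfold eP eN eM cV cF cH tau
  fun_prop (disch := assumption)

theorem eQ_cd (ε L : ℝ) (y a b c : ℝ × ℝ → ℝ) (p : ℝ × ℝ) (hp : 0 < p.1)
    (hy : ContDiffAt ℝ 1 y p) (ha : ContDiffAt ℝ 1 a p) (hb : ContDiffAt ℝ 1 b p)
    (hc : ContDiffAt ℝ 1 c p) :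
    ContDiffAt ℝ 1 (fun p => eQ ε L p.1 p.2 (y p) (a p) (b p) (c p)) p := by
  have hd : (p.1 ^ 2 + p.2 ^ 2) ^ 3 ≠ 0 := by positivity
  unfold eQ cV cF cH cH1 tau
  fun_prop (disch := assumption)

/-- the time weight -/
def rho (δ C0 t : ℝ) : ℝ := t ^ (-δ) * exp (C0 / t)

theorem rho_pos (δ C0 t : ℝ) (ht : 0 < t) : 0 < rho δ C0 t := by
  unfold rho; have := rpow_pos_of_pos ht (-δ); positivity

theorem rho_deriv (δ C0 t : ℝ) (ht : 0 < t) :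
    HasDerivAt (rho δ C0) (-(δ / t + C0 / t ^ 2) * rho δ C0 t) t := by
  have h1 := Real.hasDerivAt_rpow_const (x := t) (p := -δ) (Or.inl ht.ne')
  have h2 : HasDerivAt (fun t => C0 / t) (-C0 / t ^ 2) t := by
    have := (hasDerivAt_inv ht.ne').const_mul C0
    refine this.congr_deriv ?_
    field_simp
  refine (h1.mul h2.exp).congr_deriv ?_
  unfold rho
  rw [rpow_sub_one ht.ne']
  field_simp
  ring

theorem rho_cd (δ C0 : ℝ) (p : ℝ × ℝ) (hp : 0 < p.1) :
    ContDiffAt ℝ 1 (fun p : ℝ × ℝ => rho δ C0 p.1) p := by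
  have h1 : ContDiffAt ℝ 1 (fun p : ℝ × ℝ => p.1 ^ (-δ)) p :=
    contDiffAt_fst.rpow_const_of_ne hp.ne'
  have h2 : ContDiffAt ℝ 1 (fun p : ℝ × ℝ => C0 / p.1) p :=
    contDiffAt_const.div contDiffAt_fst hp.ne'
  unfold rho
  exact h1.mul h2.exp

theorem Sm.cda {ξ : ℝ → ℝ → ℝ} (h : Sm ξ) (p : ℝ × ℝ) :
    ContDiffAt ℝ 1 (fun p : ℝ × ℝ => ξ p.1 p.2) p := by
  have : ContDiff ℝ 1 (Function.uncurry ξ) := h.of_le (by exact_mod_cast le_top)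
  exact this.contDiffAt

/-- the conformal energy monotonicity -/
theorem conf_mono {M : ℝ} {r : ℝ → ℝ} (hM : 0 < M) (hr : IsTortoise M r) (δ : ℝ)
    (hδ : 0 < δ) (hδ1 : δ < 1) :
    ∃ C0 B : ℝ, 0 < C0 ∧ 0 < B ∧ ∀ χ : ℝ → ℝ → ℝ, Sm χ →
      (∀ t s, pd_t (pd_t χ) t s = pd_s (pd_s χ) t s - cV (2 * M) (yS M r s) * χ t s) →
      ∀ b, (∀ t s, b + t ≤ s → 1 ≤ t → χ t s = 0 ∧ pd_t χ t s = 0 ∧ pd_s χ t s = 0 ∧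
        Svf χ t s = 0 ∧ pd_t (Svf χ) t s = 0 ∧ pd_s (Svf χ) t s = 0) →
      ∀ a, a ≤ b → ∀ T, 1 ≤ T →
      ∫ x in a..b, rho δ C0 T * (eP (δ / 4000) (2 * M) T (x + T) (yS M r (x + T))
          (Svf χ T (x + T)) (pd_t (Svf χ) T (x + T)) (pd_s (Svf χ) T (x + T))
        + B * eP (δ / 4000) (2 * M) T (x + T) (yS M r (x + T))
          (χ T (x + T)) (pd_t χ T (x + T)) (pd_s χ T (x + T))) ≤
      ∫ x in a..b, rho δ C0 1 * (eP (δ / 4000) (2 * M) 1 (x + 1) (yS M r (x + 1))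
          (Svf χ 1 (x + 1)) (pd_t (Svf χ) 1 (x + 1)) (pd_s (Svf χ) 1 (x + 1))
        + B * eP (δ / 4000) (2 * M) 1 (x + 1) (yS M r (x + 1))
          (χ 1 (x + 1)) (pd_t χ 1 (x + 1)) (pd_s χ 1 (x + 1))) := by
  obtain ⟨C0, B, hC0, hB, hm⟩ := master hM hr δ hδ hδ1
  refine ⟨C0, B, hC0, hB, ?_⟩
  intro χ hχ hw b hb a hab T hT
  have hX := hχ.svf
  have hXw := X_wave hM hr hχ hw
  have hys : ∀ p : ℝ × ℝ, ContDiffAt ℝ 1 (fun p : ℝ × ℝ => yS M r p.2) p := by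
    intro p
    have h1 : ContDiff ℝ 1 (yS M r) := (y_smooth hM hr).of_le (by exact_mod_cast le_top)
    exact (h1.comp contDiff_snd).contDiffAt
  have hε0 : 0 ≤ δ / 4000 := by positivity
  have hε1 : δ / 4000 ≤ 1 / 100 := by linarith
  refine energy_mono
    (fun t s => rho δ C0 t * (eP (δ / 4000) (2 * M) t s (yS M r s)
          (Svf χ t s) (pd_t (Svf χ) t s) (pd_s (Svf χ) t s)
        + B * eP (δ / 4000) (2 * M) t s (yS M r s) (χ t s) (pd_t χ t s) (pd_s χ t s)))
    (fun t s => rho δ C0 t * (eQ (δ / 4000) (2 * M) t s (yS M r s)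
          (Svf χ t s) (pd_t (Svf χ) t s) (pd_s (Svf χ) t s)
        + B * eQ (δ / 4000) (2 * M) t s (yS M r s) (χ t s) (pd_t χ t s) (pd_s χ t s)))
    ?_ ?_ ?_ ?_ a b hab ?_ T hT
  · intro t s ht
    exact (rho_cd δ C0 (t, s) ht).mul ((eP_cd _ _ _ _ _ _ (t, s) ht (hys _) (hX.cda _)
      (hX.pdt.cda _) (hX.pds.cda _)).add (contDiffAt_const.mul (eP_cd _ _ _ _ _ _ (t, s) ht (hys _)
      (hχ.cda _) (hχ.pdt.cda _) (hχ.pds.cda _))))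
  · intro t s ht
    exact (rho_cd δ C0 (t, s) ht).mul ((eQ_cd _ _ _ _ _ _ (t, s) ht (hys _) (hX.cda _)
      (hX.pdt.cda _) (hX.pds.cda _)).add (contDiffAt_const.mul (eQ_cd _ _ _ _ _ _ (t, s) ht (hys _)
      (hχ.cda _) (hχ.pdt.cda _) (hχ.pds.cda _))))
  · intro t s pt qs ht hpt hqs
    have ht0 : 0 < t := by linarith
    have hne : t ^ 2 + s ^ 2 ≠ 0 := by positivity
    have hy := y_deriv2 hM hr s
    have P1 := eP_derivT (δ / 4000) (2 * M) t s (yS M r s) _ _ _ _ _ _ hne (hX.hasT t s)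
      (hX.pdt.hasT t s) (hX.pds.hasT t s)
    have P2 := eP_derivT (δ / 4000) (2 * M) t s (yS M r s) _ _ _ _ _ _ hne (hχ.hasT t s)
      (hχ.pdt.hasT t s) (hχ.pds.hasT t s)
    have Q1 := eQ_derivS (δ / 4000) (2 * M) t s _ _ _ _ _ _ _ hne hy (hX.hasS t s)
      (hX.pdt.hasS t s) (hX.pds.hasS t s)
    have Q2 := eQ_derivS (δ / 4000) (2 * M) t s _ _ _ _ _ _ _ hne hy (hχ.hasS t s)
      (hχ.pdt.hasS t s) (hχ.pds.hasS t s)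
    have hP := hpt.unique ((rho_deriv δ C0 t ht0).mul (P1.add (P2.const_mul B)))
    have hQ := hqs.unique ((Q1.add (Q2.const_mul B)).const_mul (rho δ C0 t))
    have I1 := div_identity (δ / 4000) (2 * M) t s (yS M r s) (Svf χ t s) (pd_t (Svf χ) t s)
      (pd_s (Svf χ) t s) (pd_t (pd_t (Svf χ)) t s) (pd_s (pd_t (Svf χ)) t s)
      (pd_s (pd_s (Svf χ)) t s) _ (hXw t s)
    have I2 := div_identity (δ / 4000) (2 * M) t s (yS M r s) (χ t s) (pd_t χ t s)
      (pd_s χ t s) (pd_t (pd_t χ) t s) (pd_s (pd_t χ) t s)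
      (pd_s (pd_s χ) t s) 0 (by rw [hw t s]; ring)
    have hmm := hm t s (χ t s) (pd_t χ t s) (pd_s χ t s) (Svf χ t s) (pd_t (Svf χ) t s)
      (pd_s (Svf χ) t s) ht
    rw [hX.comm t s] at hP
    rw [hχ.comm t s] at hP
    rw [hP, hQ]
    have hρ := rho_pos δ C0 t ht0
    have fin := mul_nonpos_of_nonneg_of_nonpos hρ.le hmm
    rw [zero_mul, zero_add] at I2
    rw [← I1, ← I2] at fin
    refine le_trans (le_of_eq ?_) fin
    ring
  · intro t s ht
    have ht0 : 0 < t := by linarith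
    have hy0 := y_pos hM hr s
    have hy1 := y_lt hM hr s
    have hρ := rho_pos δ C0 t ht0
    have k1 := eQ_le_eP (L := 2 * M) hy0 hy1 (δ / 4000) t s (Svf χ t s) (pd_t (Svf χ) t s)
      (pd_s (Svf χ) t s) ht0 hε0 hε1
    have k2 := eQ_le_eP (L := 2 * M) hy0 hy1 (δ / 4000) t s (χ t s) (pd_t χ t s)
      (pd_s χ t s) ht0 hε0 hε1
    gcongr
  · intro t ht
    obtain ⟨z1, z2, z3, z4, z5, z6⟩ := hb t (b + t) le_rfl ht
    simp only [z1, z2, z3, z4, z5, z6]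
    constructor
    · unfold eP eN eM; ring
    · unfold eQ; ring

/-- the conformal density of the statement -/
def dn (Y R t s a b c : ℝ) : ℝ :=
  (((t - s) / 2) ^ 2 * (b - c) ^ 2 + ((t + s) / 2) ^ 2 * (b + c) ^ 2
    + Y * ((t ^ 2 + s ^ 2) / R ^ 2) * a ^ 2) * R ^ 2

/-- zeroth order part -/
def zn (y R t s a : ℝ) : ℝ := (t ^ 2 + s ^ 2) * y ^ 2 / R ^ 2 * a ^ 2

theorem dn_nonneg (Y R t s a b c : ℝ) (hY : 0 ≤ Y) : 0 ≤ dn Y R t s a b c := by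
  unfold dn; positivity

theorem zn_nonneg (y R t s a : ℝ) : 0 ≤ zn y R t s a := by
  unfold zn; positivity

theorem sq_add_le (u v : ℝ) : (u + v) ^ 2 ≤ 2 * u ^ 2 + 2 * v ^ 2 := by
  nlinarith [sq_nonneg (u - v)]

theorem eN_add (L t s y a b c a' b' c' : ℝ) (hy0 : 0 < y) (hy1 : y < 1) :
    eN L t s y (a + a') (b + b') (c + c') ≤
      2 * eN L t s y a b c + 2 * eN L t s y a' b' c' := by
  have h := eN_nonneg L t s y (a - a') (b - b') (c - c') hy0 hy1
  unfold eN at *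
  linarith

theorem dn_add (Y R t s a b c a' b' c' : ℝ) (hY : 0 ≤ Y) :
    dn Y R t s (a + a') (b + b') (c + c') ≤
      2 * dn Y R t s a b c + 2 * dn Y R t s a' b' c' := by
  have h := dn_nonneg Y R t s (a - a') (b - b') (c - c') hY
  unfold dn at *
  linarith

theorem cV_R {L y R : ℝ} (hL : 0 < L) (hR : R * (1 - y ^ 2) = L) :
    cV L y = y ^ 2 * (1 - y ^ 2) / R ^ 2 := by
  have hR0 : R ≠ 0 := by rintro rfl; linarith
  have hx0 : 1 - y ^ 2 ≠ 0 := by intro h; rw [h] at hR; linarith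
  unfold cV
  rw [← hR]
  field_simp

theorem dA {L y R : ℝ} (hL : 0 < L) (hy0 : 0 < y) (hy1 : y < 1) (hRp : 0 < R)
    (hR : R * (1 - y ^ 2) = L) (K g g' t s a b c : ℝ) (hg : g ^ 2 ≤ K ^ 2 * R ^ 2)
    (hg' : g' ^ 2 ≤ K ^ 2 * y ^ 2) :
    eN L t s y (g * a) (g * b) (g' * a + g * c) ≤ 2 * K ^ 2 * dn (y ^ 2) R t s a b c := by
  have hx0 : 0 ≤ 1 - y ^ 2 := by nlinarith
  rw [eN_eq, cV_R hL hR]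
  have h1 : (g * b - (g' * a + g * c)) ^ 2 ≤ 2 * (K ^ 2 * R ^ 2) * (b - c) ^ 2
      + 2 * (K ^ 2 * y ^ 2) * a ^ 2 := by
    have e := sq_add_le (g * (b - c)) (-(g' * a))
    have k1 := mul_le_mul_of_nonneg_right hg (sq_nonneg (b - c))
    have k2 := mul_le_mul_of_nonneg_right hg' (sq_nonneg a)
    have e2 : g * b - (g' * a + g * c) = g * (b - c) + -(g' * a) := by ring
    rw [e2]; linarith
  have h2 : (g * b + (g' * a + g * c)) ^ 2 ≤ 2 * (K ^ 2 * R ^ 2) * (b + c) ^ 2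
      + 2 * (K ^ 2 * y ^ 2) * a ^ 2 := by
    have e := sq_add_le (g * (b + c)) (g' * a)
    have k1 := mul_le_mul_of_nonneg_right hg (sq_nonneg (b + c))
    have k2 := mul_le_mul_of_nonneg_right hg' (sq_nonneg a)
    have e2 : g * b + (g' * a + g * c) = g * (b + c) + g' * a := by ring
    rw [e2]; linarith
  have h3 : y ^ 2 * (1 - y ^ 2) / R ^ 2 * (g * a) ^ 2 ≤ K ^ 2 * y ^ 2 * a ^ 2 := by
    have k1 : y ^ 2 * (1 - y ^ 2) / R ^ 2 * g ^ 2 ≤ y ^ 2 * (1 - y ^ 2) / R ^ 2 * (K ^ 2 * R ^ 2) :=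
      mul_le_mul_of_nonneg_left hg (by positivity)
    have k2 : y ^ 2 * (1 - y ^ 2) / R ^ 2 * (K ^ 2 * R ^ 2) = K ^ 2 * y ^ 2 * (1 - y ^ 2) := by
      field_simp
    have k3 : K ^ 2 * y ^ 2 * (1 - y ^ 2) ≤ K ^ 2 * y ^ 2 := by
      have : 0 ≤ K ^ 2 * y ^ 2 := by positivity
      nlinarith [sq_nonneg y]
    have := mul_le_mul_of_nonneg_right (k1.trans (k2.le.trans k3)) (sq_nonneg a)
    linarith
  have m1 := mul_le_mul_of_nonneg_left h1 (sq_nonneg (t - s))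
  have m2 := mul_le_mul_of_nonneg_left h2 (sq_nonneg (t + s))
  have m3 := mul_le_mul_of_nonneg_left h3 (by positivity : 0 ≤ t ^ 2 + s ^ 2)
  have e : dn (y ^ 2) R t s a b c = R ^ 2 * (1 / 4 * ((t - s) ^ 2 * (b - c) ^ 2)
      + 1 / 4 * ((t + s) ^ 2 * (b + c) ^ 2)) + y ^ 2 * (t ^ 2 + s ^ 2) * a ^ 2 := by
    unfold dn; field_simp; ring
  rw [e]
  have m4 : 0 ≤ (t ^ 2 + s ^ 2) * (K ^ 2 * y ^ 2 * a ^ 2) := by positivity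
  linarith

theorem dB {L y R : ℝ} (hy0 : 0 < y) (hy1 : y < 1) (hRp : 0 < R)
    (K g g' t s a b c : ℝ) (hg : g ^ 2 * R ^ 2 ≤ K ^ 2)
    (hg' : g' ^ 2 * R ^ 2 ≤ K ^ 2 * (y ^ 2 / R ^ 2)) :
    dn (y ^ 2) R t s (g * a) (g * b) (g' * a + g * c) ≤
      2 * K ^ 2 * (eN L t s y a b c + zn y R t s a) := by
  have hV := cV_nonneg L y hy0 hy1
  have h1 : (g * b - (g' * a + g * c)) ^ 2 * R ^ 2 ≤ 2 * K ^ 2 * (b - c) ^ 2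
      + 2 * (K ^ 2 * (y ^ 2 / R ^ 2)) * a ^ 2 := by
    have e := mul_le_mul_of_nonneg_right (sq_add_le (g * (b - c)) (-(g' * a))) (sq_nonneg R)
    have k1 := mul_le_mul_of_nonneg_right hg (sq_nonneg (b - c))
    have k2 := mul_le_mul_of_nonneg_right hg' (sq_nonneg a)
    have e2 : g * b - (g' * a + g * c) = g * (b - c) + -(g' * a) := by ring
    rw [e2]; linarith
  have h2 : (g * b + (g' * a + g * c)) ^ 2 * R ^ 2 ≤ 2 * K ^ 2 * (b + c) ^ 2
      + 2 * (K ^ 2 * (y ^ 2 / R ^ 2)) * a ^ 2 := by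
    have e := mul_le_mul_of_nonneg_right (sq_add_le (g * (b + c)) (g' * a)) (sq_nonneg R)
    have k1 := mul_le_mul_of_nonneg_right hg (sq_nonneg (b + c))
    have k2 := mul_le_mul_of_nonneg_right hg' (sq_nonneg a)
    have e2 : g * b + (g' * a + g * c) = g * (b + c) + g' * a := by ring
    rw [e2]; linarith
  have h3 : y ^ 2 * ((t ^ 2 + s ^ 2) / R ^ 2) * (g * a) ^ 2 * R ^ 2 ≤ K ^ 2 * zn y R t s a := by
    have := mul_le_mul_of_nonneg_right hg (zn_nonneg y R t s a)
    refine le_trans (le_of_eq ?_) this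
    unfold zn; ring
  have m1 := mul_le_mul_of_nonneg_left h1 (sq_nonneg (t - s))
  have m2 := mul_le_mul_of_nonneg_left h2 (sq_nonneg (t + s))
  have e : 2 * (K ^ 2 * (y ^ 2 / R ^ 2)) * a ^ 2 * (t ^ 2 + s ^ 2) = 2 * K ^ 2 * zn y R t s a := by
    unfold zn; ring
  have m4 : 0 ≤ K ^ 2 * ((t ^ 2 + s ^ 2) * (cV L y * a ^ 2)) := by positivity
  have m5 : 0 ≤ K ^ 2 * zn y R t s a := mul_nonneg (sq_nonneg K) (zn_nonneg _ _ _ _ _)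
  rw [eN_eq]
  unfold dn
  linarith

section W
variable {M : ℝ} {r : ℝ → ℝ}

/-- the multiplier `k = s (1-μ)` -/
def kS (M : ℝ) (r : ℝ → ℝ) (s : ℝ) : ℝ := s * yS M r s ^ 2
def kS1 (M : ℝ) (r : ℝ → ℝ) (s : ℝ) : ℝ :=
  yS M r s ^ 2 + s * (yS M r s ^ 2 * (1 - yS M r s ^ 2) ^ 2 / (2 * M))

theorem kS_deriv (hM : 0 < M) (hr : IsTortoise M r) (s : ℝ) :
    HasDerivAt (kS M r) (kS1 M r s) s := by
  have := (hasDerivAt_id s).mul (y2_deriv hM hr s)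
  refine this.congr_deriv ?_
  simp [kS1]

theorem kS_bound (hM : 0 < M) (hr : IsTortoise M r) :
    ∃ K : ℝ, 1 ≤ K ∧ ∀ s, kS M r s ^ 2 ≤ K ^ 2 * r s ^ 2 ∧ kS1 M r s ^ 2 ≤ K ^ 2 * yS M r s ^ 2 := by
  obtain ⟨U, hU, hs⟩ := stat_U hM hr
  refine ⟨1 + U / (2 * M), by have : 0 < U / (2 * M) := by positivity
                              linarith, ?_⟩
  intro s
  have hy0 := y_pos hM hr s
  have hy1 := y_lt hM hr s
  have hx := r_mul_x hM hr s
  have hr0 := r_pos hM hr s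
  have h := hs s
  unfold kS kS1
  set y := yS M r s
  have hx0 : 0 < 1 - y ^ 2 := by nlinarith
  have hx1 : 1 - y ^ 2 ≤ 1 := by nlinarith
  have hz : 0 ≤ |s| * (1 - y ^ 2) := by positivity
  have h1 : y * (|s| * (1 - y ^ 2)) ≤ U := by
    refine le_trans ?_ h
    gcongr
    have : (1 : ℝ) ≤ (1 + |s| * (1 - y ^ 2)) ^ 3 := one_le_pow₀ (by linarith)
    nlinarith
  have hUM : U / (2 * M) * (2 * M) = U := by field_simp
  have hUp : 0 < U / (2 * M) := by positivity
  constructor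
  · rw [← sq_abs (s * y ^ 2), ← mul_pow]
    apply pow_le_pow_left₀ (abs_nonneg _)
    rw [abs_mul, abs_of_pos (by positivity : 0 < y ^ 2)]
    have h2 : |s| * y ^ 2 * (1 - y ^ 2) ≤ (1 + U / (2 * M)) * r s * (1 - y ^ 2) := by
      have e : (1 + U / (2 * M)) * r s * (1 - y ^ 2) = 2 * M + U := by
        rw [mul_assoc, hx, add_mul, hUM]; ring
      rw [e]
      have : |s| * y ^ 2 * (1 - y ^ 2) ≤ 1 * (y * (|s| * (1 - y ^ 2))) := by
        have : |s| * y ^ 2 * (1 - y ^ 2) = y * (y * (|s| * (1 - y ^ 2))) := by ring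
        rw [this]; gcongr
      linarith
    exact le_of_mul_le_mul_right h2 hx0
  · rw [← sq_abs (y ^ 2 + _), ← mul_pow (1 + U / (2 * M)) y]
    apply pow_le_pow_left₀ (abs_nonneg _)
    refine (abs_add_le _ _).trans ?_
    rw [abs_of_pos (by positivity : 0 < y ^ 2), abs_mul,
      abs_of_pos (by positivity : 0 < y ^ 2 * (1 - y ^ 2) ^ 2 / (2 * M))]
    have e : |s| * (y ^ 2 * (1 - y ^ 2) ^ 2 / (2 * M)) =
      y * (y * (|s| * (1 - y ^ 2)) * (1 - y ^ 2) / (2 * M)) := by ring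
    have h3 : y * (|s| * (1 - y ^ 2)) * (1 - y ^ 2) / (2 * M) ≤ U / (2 * M) := by
      gcongr
      have : 0 ≤ y * (|s| * (1 - y ^ 2)) := by positivity
      nlinarith
    rw [e]
    have := mul_le_mul_of_nonneg_left h3 hy0.le
    nlinarith

theorem X_eq (hM : 0 < M) (hr : IsTortoise M r) {φ : ℝ → ℝ → ℝ} (h : Sm φ) :
    Svf (fun t s => r s * φ t s) = fun t s => r s * Svf φ t s + kS M r s * φ t s := by
  ext t s
  unfold Svf
  rw [chi_t r h, mulS_s h t s (r_deriv' hM hr s)]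
  unfold kS; ring

theorem add_t {ξ η : ℝ → ℝ → ℝ} (h1 : Sm ξ) (h2 : Sm η) (t s : ℝ) :
    pd_t (fun t s => ξ t s + η t s) t s = pd_t ξ t s + pd_t η t s :=
  ((h1.hasT t s).add (h2.hasT t s)).deriv

theorem add_s {ξ η : ℝ → ℝ → ℝ} (h1 : Sm ξ) (h2 : Sm η) (t s : ℝ) :
    pd_s (fun t s => ξ t s + η t s) t s = pd_s ξ t s + pd_s η t s :=
  ((h1.hasS t s).add (h2.hasS t s)).deriv

theorem kS_smooth (hM : 0 < M) (hr : IsTortoise M r) : ContDiff ℝ (⊤ : ℕ∞) (kS M r) :=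
  contDiff_id.mul ((y_smooth hM hr).pow 2)

/-- comparison of energies: initial slice -/
theorem cmpA (hM : 0 < M) (hr : IsTortoise M r) : ∃ K : ℝ, 0 < K ∧
    ∀ φ : ℝ → ℝ → ℝ, Sm φ → ∀ t s,
      eN (2 * M) t s (yS M r s) (r s * φ t s) (pd_t (fun t s => r s * φ t s) t s)
        (pd_s (fun t s => r s * φ t s) t s) ≤
        K * dn (yS M r s ^ 2) (r s) t s (φ t s) (pd_t φ t s) (pd_s φ t s) ∧
      eN (2 * M) t s (yS M r s) (Svf (fun t s => r s * φ t s) t s)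
        (pd_t (Svf (fun t s => r s * φ t s)) t s)
        (pd_s (Svf (fun t s => r s * φ t s)) t s) ≤
        K * (dn (yS M r s ^ 2) (r s) t s (φ t s) (pd_t φ t s) (pd_s φ t s)
          + dn (yS M r s ^ 2) (r s) t s (Svf φ t s) (pd_t (Svf φ) t s) (pd_s (Svf φ) t s)) := by
  obtain ⟨K, hK, hk⟩ := kS_bound hM hr
  refine ⟨4 * K ^ 2, by positivity, ?_⟩
  intro φ hφ t s
  obtain ⟨k1, k2⟩ := hk s
  have hy0 := y_pos hM hr s
  have hy1 := y_lt hM hr s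
  have hx := r_mul_x hM hr s
  have hr0 := r_pos hM hr s
  have hL : 0 < 2 * M := by positivity
  have hψ := hφ.svf
  have hrs := r_smooth hM hr
  have hks := kS_smooth hM hr
  have hd := dn_nonneg (yS M r s ^ 2) (r s) t s (φ t s) (pd_t φ t s) (pd_s φ t s) (sq_nonneg _)
  have hd2 := dn_nonneg (yS M r s ^ 2) (r s) t s (Svf φ t s) (pd_t (Svf φ) t s) (pd_s (Svf φ) t s)
    (sq_nonneg _)
  have hK2 : 1 ≤ K ^ 2 := one_le_pow₀ hK
  have hRc : ∀ a b c : ℝ, eN (2 * M) t s (yS M r s) (r s * a) (r s * b)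
      (yS M r s ^ 2 * a + r s * c) ≤ 2 * 1 ^ 2 * dn (yS M r s ^ 2) (r s) t s a b c := by
    intro a b c
    refine dA hL hy0 hy1 hr0 hx 1 (r s) (yS M r s ^ 2) t s a b c (by simp) ?_
    nlinarith [sq_nonneg (yS M r s)]
  constructor
  · rw [chi_t r hφ, mulS_s hφ t s (r_deriv' hM hr s)]
    refine (hRc _ _ _).trans ?_
    nlinarith
  · have hkd := dA hL hy0 hy1 hr0 hx K (kS M r s) (kS1 M r s) t s (φ t s) (pd_t φ t s)
      (pd_s φ t s) k1 k2
    have hrd := hRc (Svf φ t s) (pd_t (Svf φ) t s) (pd_s (Svf φ) t s)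
    rw [X_eq hM hr hφ, add_t (hψ.mulS hrs) (hφ.mulS hks), add_s (hψ.mulS hrs) (hφ.mulS hks),
      chi_t r hψ, chi_t (kS M r) hφ, mulS_s hψ t s (r_deriv' hM hr s),
      mulS_s hφ t s (kS_deriv hM hr s)]
    refine (eN_add _ _ _ _ _ _ _ _ _ _ hy0 hy1).trans ?_
    nlinarith

/-- comparison of energies: final slice -/
theorem cmpB (hM : 0 < M) (hr : IsTortoise M r) : ∃ K : ℝ, 0 < K ∧
    ∀ φ : ℝ → ℝ → ℝ, Sm φ → ∀ t s,
      dn (yS M r s ^ 2) (r s) t s (Svf φ t s) (pd_t (Svf φ) t s) (pd_s (Svf φ) t s) ≤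
      K * ((eN (2 * M) t s (yS M r s) (r s * φ t s) (pd_t (fun t s => r s * φ t s) t s)
        (pd_s (fun t s => r s * φ t s) t s) + zn (yS M r s) (r s) t s (r s * φ t s)) +
      (eN (2 * M) t s (yS M r s) (Svf (fun t s => r s * φ t s) t s)
        (pd_t (Svf (fun t s => r s * φ t s)) t s)
        (pd_s (Svf (fun t s => r s * φ t s)) t s)
        + zn (yS M r s) (r s) t s (Svf (fun t s => r s * φ t s) t s))) := by
  obtain ⟨K, hK, hk⟩ := kS_bound hM hr
  refine ⟨36 * K ^ 2, by positivity, ?_⟩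
  intro φ hφ t s
  have hrs := r_smooth hM hr
  have hks := kS_smooth hM hr
  set χ : ℝ → ℝ → ℝ := fun t s => r s * φ t s with hχd
  have hχ : Sm χ := hφ.mulS hrs
  have hX : Sm (Svf χ) := hχ.svf
  have hr0 := r_pos hM hr
  set g1 : ℝ → ℝ := fun s => 1 / r s with hg1
  set g2 : ℝ → ℝ := fun s => -(kS M r s / r s ^ 2) with hg2
  have hg1s : ContDiff ℝ (⊤ : ℕ∞) g1 := contDiff_const.div hrs (fun s => (hr0 s).ne')
  have hg2s : ContDiff ℝ (⊤ : ℕ∞) g2 :=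
    (hks.div (hrs.pow 2) (fun s => pow_ne_zero 2 (hr0 s).ne')).neg
  have hψ : Svf φ = fun t s => g1 s * Svf χ t s + g2 s * χ t s := by
    ext t s
    rw [hχd, X_eq hM hr hφ]
    have := (hr0 s).ne'
    simp only [hg1, hg2]
    field_simp
    ring
  have hg1d : HasDerivAt g1 (-(yS M r s ^ 2 / r s ^ 2)) s := by
    have := (hasDerivAt_const s (1 : ℝ)).div (r_deriv' hM hr s) (hr0 s).ne'
    refine this.congr_deriv ?_
    ring
  have hg2d : HasDerivAt g2 (-(kS1 M r s / r s ^ 2 - 2 * kS M r s * yS M r s ^ 2 / r s ^ 3)) s := by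
    have := ((kS_deriv hM hr s).div ((r_deriv' hM hr s).fun_pow 2)
      (pow_ne_zero 2 (hr0 s).ne')).neg
    refine this.congr_deriv ?_
    have := (hr0 s).ne'
    push_cast
    field_simp
  obtain ⟨k1, k2⟩ := hk s
  have hy0 := y_pos hM hr s
  have hy1 := y_lt hM hr s
  have hrp := hr0 s
  have e1 := dB (L := 2 * M) hy0 hy1 hrp 1 (g1 s) (-(yS M r s ^ 2 / r s ^ 2)) t s (Svf χ t s)
    (pd_t (Svf χ) t s) (pd_s (Svf χ) t s) (by simp only [hg1]; field_simp; simp) (by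
      have : (-(yS M r s ^ 2 / r s ^ 2)) ^ 2 * r s ^ 2 = (yS M r s ^ 2 / r s ^ 2) * yS M r s ^ 2 := by
        field_simp
      rw [this, one_pow, one_mul]
      refine mul_le_of_le_one_right (by positivity) ?_
      nlinarith)
  have e2 := dB (L := 2 * M) hy0 hy1 hrp (3 * K) (g2 s)
    (-(kS1 M r s / r s ^ 2 - 2 * kS M r s * yS M r s ^ 2 / r s ^ 3)) t s (χ t s)
    (pd_t χ t s) (pd_s χ t s) (by
      have : g2 s ^ 2 * r s ^ 2 = kS M r s ^ 2 / r s ^ 2 := by simp only [hg2]; field_simp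
      rw [this, div_le_iff₀ (by positivity)]
      nlinarith [sq_nonneg (K * r s)]) (by
      have : (-(kS1 M r s / r s ^ 2 - 2 * kS M r s * yS M r s ^ 2 / r s ^ 3)) ^ 2 * r s ^ 2
        = (kS1 M r s + -(2 * kS M r s * yS M r s ^ 2 / r s)) ^ 2 / r s ^ 2 := by
        field_simp; ring
      rw [this, ← mul_div_assoc]
      apply div_le_div_of_nonneg_right _ (by positivity)
      have f1 : (2 * kS M r s * yS M r s ^ 2 / r s) ^ 2 ≤ (2 * K * yS M r s) ^ 2 := by
        have : (2 * kS M r s * yS M r s ^ 2 / r s) ^ 2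
          = 4 * (kS M r s ^ 2) * (yS M r s ^ 2 / r s ^ 2 * yS M r s ^ 2) := by field_simp; ring
        rw [this]
        have g3 := mul_le_mul_of_nonneg_right k1
          (by positivity : 0 ≤ (yS M r s ^ 2 / r s ^ 2 * yS M r s ^ 2))
        have g4 : K ^ 2 * r s ^ 2 * (yS M r s ^ 2 / r s ^ 2 * yS M r s ^ 2)
          = K ^ 2 * yS M r s ^ 2 * yS M r s ^ 2 := by field_simp
        have g5 : K ^ 2 * yS M r s ^ 2 * yS M r s ^ 2 ≤ K ^ 2 * yS M r s ^ 2 :=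
          mul_le_of_le_one_right (by positivity) (by nlinarith)
        linarith
      have a1 : |kS1 M r s| ≤ K * yS M r s := by
        apply abs_le_of_sq_le_sq _ (by positivity)
        linarith [mul_pow K (yS M r s) 2]
      have a2 : |2 * kS M r s * yS M r s ^ 2 / r s| ≤ 2 * K * yS M r s :=
        abs_le_of_sq_le_sq f1 (by positivity)
      rw [← mul_pow]
      apply sq_le_sq'
      · have := abs_le.1 a1; have := abs_le.1 a2; linarith
      · have := abs_le.1 a1; have := abs_le.1 a2; linarith)
  rw [hψ, add_t (hX.mulS hg1s) (hχ.mulS hg2s), add_s (hX.mulS hg1s) (hχ.mulS hg2s),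
      chi_t g1 hX, chi_t g2 hχ, mulS_s hX t s hg1d, mulS_s hχ t s hg2d]
  refine (dn_add _ _ _ _ _ _ _ _ _ _ (sq_nonneg _)).trans ?_
  have hK2 : 1 ≤ K ^ 2 := one_le_pow₀ hK
  have n1 := eN_nonneg (2 * M) t s (yS M r s) (Svf χ t s) (pd_t (Svf χ) t s) (pd_s (Svf χ) t s)
    hy0 hy1
  have n2 := zn_nonneg (yS M r s) (r s) t s (Svf χ t s)
  nlinarith

/-- pointwise Hardy -/
theorem hardy_pt (hM : 0 < M) (hr : IsTortoise M r) {ξ : ℝ → ℝ → ℝ} (h : Sm ξ) (t s : ℝ)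
    (ht : 1 ≤ t) : ∃ G' : ℝ,
    HasDerivAt (fun s => (s ^ 2 - t ^ 2) * (yS M r s ^ 2 / r s) * ξ t s ^ 2) G' s ∧
    zn (yS M r s) (r s) t s (ξ t s) ≤ 4 * G' + (352 + 40 * M) *
      eN (2 * M) t s (yS M r s) (ξ t s) (pd_t ξ t s) (pd_s ξ t s) := by
  have hy0 := y_pos hM hr s
  have hy1 := y_lt hM hr s
  have hx := r_mul_x hM hr s
  have hr0 := r_pos hM hr s
  have hst := stat_hardy hM hr t s ht
  have hL : 0 < 2 * M := by positivity
  have hd1 : HasDerivAt (fun s : ℝ => s ^ 2 - t ^ 2) (2 * s) s := by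
    simpa using (hasDerivAt_pow 2 s).sub_const (t ^ 2)
  have hd2 : HasDerivAt (fun s => yS M r s ^ 2 / r s)
      (yS M r s ^ 2 / r s ^ 2 * (2 * (1 - yS M r s ^ 2) - 1)) s := by
    refine ((y2_deriv hM hr s).div (r_deriv' hM hr s) hr0.ne').congr_deriv ?_
    rw [← hx]
    have hx0 : 1 - yS M r s ^ 2 ≠ 0 := by nlinarith
    field_simp
    ring
  refine ⟨_, (hd1.mul hd2).mul ((h.hasS t s).fun_pow 2), ?_⟩
  set y := yS M r s
  set R := r s
  set a := ξ t s
  set b := pd_t ξ t s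
  set c := pd_s ξ t s
  have hV := cV_R hL hx
  have am : ∀ p q f : ℝ, |p * q * (y ^ 2 / R) * a * f| ≤ 2 * (p ^ 2 * f ^ 2)
      + q ^ 2 * (y ^ 2 / R ^ 2 * a ^ 2) / 8 := by
    intro p q f
    have := amgm (p * f) (q * (y ^ 2 / R) * a) 2 (by norm_num)
    have e1 : p * f * (q * (y ^ 2 / R) * a) = p * q * (y ^ 2 / R) * a * f := by ring
    have e2 : (q * (y ^ 2 / R) * a) ^ 2 / (4 * 2) = q ^ 2 * (y ^ 2 / R ^ 2 * a ^ 2) / 8 * y ^ 2 := by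
      field_simp; ring
    rw [e1, e2] at this
    have e3 : q ^ 2 * (y ^ 2 / R ^ 2 * a ^ 2) / 8 * y ^ 2 ≤ q ^ 2 * (y ^ 2 / R ^ 2 * a ^ 2) / 8 :=
      mul_le_of_le_one_right (by positivity) (by nlinarith)
    linarith [mul_pow p f 2]
  have a1 := (abs_le.1 (am (t + s) (t - s) (b + c))).2
  have a2 := (abs_le.1 (am (t - s) (t + s) (b - c))).1
  have hst2 := mul_le_mul_of_nonneg_right hst (by positivity : 0 ≤ y ^ 2 / R ^ 2 * a ^ 2)
  have ez : zn y R t s a = (t ^ 2 + s ^ 2) * (y ^ 2 / R ^ 2 * a ^ 2) := by unfold zn; ring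
  have eV : cV (2 * M) y * a ^ 2 = (1 - y ^ 2) * (y ^ 2 / R ^ 2 * a ^ 2) := by rw [hV]; ring
  have eG : (2 * s * (y ^ 2 / R) + (s ^ 2 - t ^ 2) * (y ^ 2 / R ^ 2 * (2 * (1 - y ^ 2) - 1))) * a ^ 2
      + (s ^ 2 - t ^ 2) * (y ^ 2 / R) * (2 * a * c)
      = (2 * s * R - (s ^ 2 - t ^ 2) * (1 - 2 * (1 - y ^ 2))) * (y ^ 2 / R ^ 2 * a ^ 2)
        - (t + s) * (t - s) * (y ^ 2 / R) * a * (b + c)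
        + (t - s) * (t + s) * (y ^ 2 / R) * a * (b - c) := by
    field_simp; ring
  have goalG : zn y R t s a ≤ 4 * ((2 * s * (y ^ 2 / R)
      + (s ^ 2 - t ^ 2) * (y ^ 2 / R ^ 2 * (2 * (1 - y ^ 2) - 1))) * a ^ 2
      + (s ^ 2 - t ^ 2) * (y ^ 2 / R) * (2 * a * c))
      + (352 + 40 * M) * eN (2 * M) t s y a b c := by
    rw [eG, ez, eN_eq, eV]
    set z := y ^ 2 / R ^ 2 * a ^ 2
    have hz : 0 ≤ z := by positivity
    have hx0 : 0 ≤ 1 - y ^ 2 := by nlinarith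
    have p1 : 0 ≤ (320 + 40 * M) * (1 / 4 * ((t - s) ^ 2 * (b - c) ^ 2)
      + 1 / 4 * ((t + s) ^ 2 * (b + c) ^ 2)) := by positivity
    have p2 : 0 ≤ (t ^ 2 + s ^ 2) * ((1 - y ^ 2) * z) := by positivity
    linarith
  refine goalG.trans (le_of_eq ?_)
  simp only [Pi.mul_apply]
  push_cast
  ring
end W

/-- vanishing outside a light cone -/
def Van (S : ℝ) (ξ : ℝ → ℝ → ℝ) : Prop := ∀ t s, S + |t - 1| < s → ξ t s = 0

theorem Van.pdt {S : ℝ} {ξ : ℝ → ℝ → ℝ} (h : Van S ξ) : Van S (pd_t ξ) := by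
  intro t s hts
  have ho : IsOpen {t' : ℝ | S + |t' - 1| < s} := isOpen_lt (by fun_prop) (by fun_prop)
  have he : (fun t' => ξ t' s) =ᶠ[nhds t] fun _ => (0 : ℝ) := by
    filter_upwards [ho.mem_nhds hts] with t' ht'
    exact h t' s ht'
  unfold pd_t
  rw [he.deriv_eq]; simp

theorem Van.pds {S : ℝ} {ξ : ℝ → ℝ → ℝ} (h : Van S ξ) : Van S (pd_s ξ) := by
  intro t s hts
  have ho : IsOpen {s' : ℝ | S + |t - 1| < s'} := isOpen_lt (by fun_prop) (by fun_prop)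
  have he : (fun s' => ξ t s') =ᶠ[nhds s] fun _ => (0 : ℝ) := by
    filter_upwards [ho.mem_nhds hts] with s' hs'
    exact h t s' hs'
  unfold pd_s
  rw [he.deriv_eq]; simp

theorem Van.svf {S : ℝ} {ξ : ℝ → ℝ → ℝ} (h : Van S ξ) : Van S (Svf ξ) := by
  intro t s hts
  unfold Svf
  rw [h.pdt t s hts, h.pds t s hts]; simp

theorem Van.mulS {S : ℝ} {ξ : ℝ → ℝ → ℝ} (g : ℝ → ℝ) (h : Van S ξ) :
    Van S (fun t s => g s * ξ t s) := by
  intro t s hts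
  simp [h t s hts]

theorem Van.at {S : ℝ} {ξ : ℝ → ℝ → ℝ} (h : Van S ξ) {t s : ℝ} (hs : S + t ≤ s) (ht : 1 ≤ t) :
    ξ t s = 0 := by
  apply h
  rw [abs_of_nonneg (by linarith)]; linarith

theorem Sm.cont {ξ : ℝ → ℝ → ℝ} (h : Sm ξ) (t : ℝ) : Continuous (fun s => ξ t s) := by
  have h1 : Continuous (Function.uncurry ξ) := ContDiff.continuous h
  exact h1.comp (Continuous.prodMk_right t)

section W
variable {M : ℝ} {r : ℝ → ℝ}

/-- `eN` of a function -/
def nN (M : ℝ) (r : ℝ → ℝ) (ξ : ℝ → ℝ → ℝ) (t s : ℝ) : ℝ :=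
  eN (2 * M) t s (yS M r s) (ξ t s) (pd_t ξ t s) (pd_s ξ t s)
/-- `eP` of a function -/
def nP (ε M : ℝ) (r : ℝ → ℝ) (ξ : ℝ → ℝ → ℝ) (t s : ℝ) : ℝ :=
  eP ε (2 * M) t s (yS M r s) (ξ t s) (pd_t ξ t s) (pd_s ξ t s)
/-- `zn` of a function -/
def nZ (M : ℝ) (r : ℝ → ℝ) (ξ : ℝ → ℝ → ℝ) (t s : ℝ) : ℝ :=
  zn (yS M r s) (r s) t s (ξ t s)
/-- `dn` of a function -/
def nD (M : ℝ) (r : ℝ → ℝ) (ξ : ℝ → ℝ → ℝ) (t s : ℝ) : ℝ :=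
  dn (yS M r s ^ 2) (r s) t s (ξ t s) (pd_t ξ t s) (pd_s ξ t s)

theorem nN_cont (hM : 0 < M) (hr : IsTortoise M r) {ξ : ℝ → ℝ → ℝ} (h : Sm ξ) (t : ℝ) :
    Continuous (nN M r ξ t) := by
  have h0 := h.cont t
  have h1 := h.pdt.cont t
  have h2 := h.pds.cont t
  have hy : Continuous (yS M r) := (y_smooth hM hr).continuous
  unfold nN eN cV
  fun_prop

theorem nP_cont (hM : 0 < M) (hr : IsTortoise M r) {ξ : ℝ → ℝ → ℝ} (h : Sm ξ) (ε t : ℝ)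
    (ht : 0 < t) : Continuous (nP ε M r ξ t) := by
  have h0 := h.cont t
  have h1 := h.pdt.cont t
  have h2 := h.pds.cont t
  have hy : Continuous (yS M r) := (y_smooth hM hr).continuous
  have hn : ∀ s : ℝ, (t ^ 2 + s ^ 2) ^ 3 ≠ 0 := fun s => by positivity
  unfold nP eP eM eN cV tau cF cH
  fun_prop (disch := exact hn)

theorem nZ_cont (hM : 0 < M) (hr : IsTortoise M r) {ξ : ℝ → ℝ → ℝ} (h : Sm ξ) (t : ℝ) :
    Continuous (nZ M r ξ t) := by
  have h0 := h.cont t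
  have hy : Continuous (yS M r) := (y_smooth hM hr).continuous
  have hrc : Continuous r := (r_smooth hM hr).continuous
  have hn : ∀ s : ℝ, r s ^ 2 ≠ 0 := fun s => by have := r_pos hM hr s; positivity
  unfold nZ zn
  fun_prop (disch := exact hn)

theorem nD_cont (hM : 0 < M) (hr : IsTortoise M r) {ξ : ℝ → ℝ → ℝ} (h : Sm ξ) (t : ℝ) :
    Continuous (nD M r ξ t) := by
  have h0 := h.cont t
  have h1 := h.pdt.cont t
  have h2 := h.pds.cont t
  have hy : Continuous (yS M r) := (y_smooth hM hr).continuous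
  have hrc : Continuous r := (r_smooth hM hr).continuous
  have hn : ∀ s : ℝ, r s ^ 2 ≠ 0 := fun s => by have := r_pos hM hr s; positivity
  unfold nD dn
  fun_prop (disch := exact hn)

/-- integrated Hardy inequality -/
theorem hardy_int (hM : 0 < M) (hr : IsTortoise M r) {ξ : ℝ → ℝ → ℝ} (h : Sm ξ) {b T N : ℝ}
    (hT : 1 ≤ T) (hN : T ≤ N) (hb : -N ≤ b + T) (h0 : ξ T (b + T) = 0) :
    ∫ s in (-N)..(b + T), nZ M r ξ T s ≤ (352 + 40 * M) * ∫ s in (-N)..(b + T), nN M r ξ T s := by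
  set G : ℝ → ℝ := fun s => (s ^ 2 - T ^ 2) * (yS M r s ^ 2 / r s) * ξ T s ^ 2 with hG
  have hGc : ContDiff ℝ 1 G := by
    have hy : ContDiff ℝ 1 (yS M r) := (y_smooth hM hr).of_le (by exact_mod_cast le_top)
    have hrc : ContDiff ℝ 1 r := (r_smooth hM hr).of_le (by exact_mod_cast le_top)
    have hx : ContDiff ℝ 1 (fun s => ξ T s) := by
      have h1 : ContDiff ℝ 1 (Function.uncurry ξ) := h.of_le (by exact_mod_cast le_top)
      exact h1.comp (contDiff_const.prodMk contDiff_id)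
    have hn : ∀ s : ℝ, r s ≠ 0 := fun s => (r_pos hM hr s).ne'
    exact (((contDiff_id.pow 2).sub contDiff_const).mul ((hy.pow 2).div hrc hn)).mul (hx.pow 2)
  have hdc : Continuous (deriv G) := hGc.continuous_deriv le_rfl
  have hp : ∀ s, nZ M r ξ T s ≤ 4 * deriv G s + (352 + 40 * M) * nN M r ξ T s := by
    intro s
    obtain ⟨G', hG', hle⟩ := hardy_pt hM hr h T s hT
    rw [show deriv G s = G' from hG'.deriv]
    exact hle
  have hNc := nN_cont hM hr h T
  have hI : ∫ s in (-N)..(b + T), nZ M r ξ T s ≤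
      ∫ s in (-N)..(b + T), (4 * deriv G s + (352 + 40 * M) * nN M r ξ T s) := by
    apply intervalIntegral.integral_mono_on hb
    · exact (nZ_cont hM hr h T).intervalIntegrable _ _
    · exact (by fun_prop : Continuous _).intervalIntegrable _ _
    · intro s _; exact hp s
  rw [intervalIntegral.integral_add ((by fun_prop : Continuous _).intervalIntegrable _ _)
    ((by fun_prop : Continuous _).intervalIntegrable _ _), intervalIntegral.integral_const_mul,
    intervalIntegral.integral_const_mul,
    intervalIntegral.integral_deriv_eq_sub (fun x _ => hGc.differentiable one_ne_zero x)
      (hdc.intervalIntegrable _ _)] at hI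
  have e1 : G (b + T) = 0 := by simp [hG, h0]
  have e2 : 0 ≤ G (-N) := by
    simp only [hG]
    have := r_pos hM hr (-N)
    have h3 : 0 ≤ (-N) ^ 2 - T ^ 2 := by nlinarith
    positivity
  linarith

theorem rho_inv (δ C0 T : ℝ) (hC0 : 0 < C0) (hT : 0 < T) : (rho δ C0 T)⁻¹ ≤ T ^ δ := by
  unfold rho
  rw [mul_inv, rpow_neg hT.le, inv_inv]
  have h1 : 1 ≤ exp (C0 / T) := one_le_exp (by positivity)
  have h2 := rpow_pos_of_pos hT δ
  have h3 : (exp (C0 / T))⁻¹ ≤ 1 := inv_le_one_of_one_le₀ h1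
  nlinarith

theorem E0I_ge (hM : 0 < M) (hr : IsTortoise M r) (ξ : ℝ → ℝ → ℝ) (s : ℝ) :
    nD M r ξ 1 s ≤ E0Integrand M r ξ s := by
  unfold nD dn E0Integrand muS
  rw [← y_sq hM hr s]
  have := y_pos hM hr s
  apply mul_le_mul_of_nonneg_right _ (by positivity)
  have h1 : 0 ≤ (yS M r s ^ 2)⁻¹ * (pd_t ξ 1 s - pd_s ξ 1 s) ^ 2 := by positivity
  have h2 : 0 ≤ (pd_t ξ 1 s + pd_s ξ 1 s) ^ 2 := by positivity
  linarith [one_pow (M := ℝ) 2]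

theorem nD_nonneg (hM : 0 < M) (hr : IsTortoise M r) (ξ : ℝ → ℝ → ℝ) (t s : ℝ) :
    0 ≤ nD M r ξ t s := dn_nonneg _ _ _ _ _ _ _ (by have := y_pos hM hr s; positivity)

theorem E0I_nonneg (hM : 0 < M) (hr : IsTortoise M r) (ξ : ℝ → ℝ → ℝ) (s : ℝ) :
    0 ≤ E0Integrand M r ξ s := (nD_nonneg hM hr ξ 1 s).trans (E0I_ge hM hr ξ s)

theorem nD_int_le (hM : 0 < M) (hr : IsTortoise M r) {ξ : ℝ → ℝ → ℝ} (h : Sm ξ)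
    (hf : FinE0 M r ξ) {a b : ℝ} (hab : a ≤ b) :
    ∫ s in a..b, nD M r ξ 1 s ≤ E0 M r ξ := by
  have h1 : ∫ s in a..b, nD M r ξ 1 s ≤ ∫ s in a..b, E0Integrand M r ξ s := by
    apply intervalIntegral.integral_mono_on hab
    · exact (nD_cont hM hr h 1).intervalIntegrable _ _
    · exact hf.intervalIntegrable
    · intro s _; exact E0I_ge hM hr ξ s
  refine h1.trans ?_
  rw [intervalIntegral.integral_of_le hab]
  exact setIntegral_le_integral hf (Filter.Eventually.of_forall (E0I_nonneg hM hr ξ))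

/-- the estimate on truncated intervals -/
theorem trunc (hM : 0 < M) (hr : IsTortoise M r) (δ : ℝ) (hδ : 0 < δ) (hδ1 : δ < 1) :
    ∃ C : ℝ, 0 < C ∧ ∀ φ : ℝ → ℝ → ℝ, IsWaveSol r φ → FinE1 M r φ → ∀ b, Van b φ →
      ∀ T, 1 ≤ T → ∀ N, T ≤ N → -N ≤ b + T →
      ∫ s in (-N)..(b + T), nD M r (Svf φ) T s ≤ C * T ^ δ * E1 M r φ := by
  obtain ⟨KA, hKA, hA⟩ := cmpA hM hr
  obtain ⟨KB, hKB, hB'⟩ := cmpB hM hr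
  obtain ⟨C0, B, hC0, hB, hmono⟩ := conf_mono hM hr δ hδ hδ1
  have hρ1 := rho_pos δ C0 1 one_pos
  refine ⟨KB * (353 + 40 * M) * (2 * (1 + 1 / B)) * (rho δ C0 1 * 2 * (KA * (1 + B))),
    by positivity, ?_⟩
  intro φ hφ hf b hv T hT N hN hNb
  have hT0 : 0 < T := by linarith
  have hφs : Sm φ := hφ.1
  set χ : ℝ → ℝ → ℝ := fun t s => r s * φ t s with hχd
  have hχ : Sm χ := hφs.mulS (r_smooth hM hr)
  have hX := hχ.svf
  have hχv : Van b χ := hv.mulS r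
  have hm := hmono χ hχ (chi_wave hM hr hφ) b
    (fun t s hs ht => ⟨hχv.at hs ht, hχv.pdt.at hs ht, hχv.pds.at hs ht, hχv.svf.at hs ht,
      hχv.svf.pdt.at hs ht, hχv.svf.pds.at hs ht⟩) (-N - T) (by linarith) T hT
  set ε := δ / 4000 with hε
  have hε0 : 0 ≤ ε := by positivity
  have hε1 : ε ≤ 1 / 100 := by rw [hε]; linarith
  have hNχ := nN_cont hM hr hχ
  have hNX := nN_cont hM hr hX
  have hPχ := fun t ht => nP_cont hM hr hχ ε t ht
  have hPX := fun t ht => nP_cont hM hr hX ε t ht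
  -- change of variables
  have hm' : rho δ C0 T * (∫ s in (-N)..(b + T), (nP ε M r (Svf χ) T s + B * nP ε M r χ T s)) ≤
      rho δ C0 1 * ∫ s in (-N - T + 1)..(b + 1), (nP ε M r (Svf χ) 1 s + B * nP ε M r χ 1 s) := by
    have e1 := intervalIntegral.integral_comp_add_right
      (a := -N - T) (b := b)
      (fun s => rho δ C0 T * (nP ε M r (Svf χ) T s + B * nP ε M r χ T s)) T
    have e2 := intervalIntegral.integral_comp_add_right
      (a := -N - T) (b := b)
      (fun s => rho δ C0 1 * (nP ε M r (Svf χ) 1 s + B * nP ε M r χ 1 s)) 1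
    rw [show -N - T + T = -N by ring] at e1
    rw [← intervalIntegral.integral_const_mul, ← intervalIntegral.integral_const_mul, ← e1, ← e2]
    exact hm
  -- lower bound
  set I0 := ∫ s in (-N)..(b + T), nN M r χ T s with hI0
  set I1 := ∫ s in (-N)..(b + T), nN M r (Svf χ) T s with hI1
  set Z0 := ∫ s in (-N)..(b + T), nZ M r χ T s with hZ0
  set Z1 := ∫ s in (-N)..(b + T), nZ M r (Svf χ) T s with hZ1
  have nn : ∀ ξ t s, 0 ≤ nN M r ξ t s := fun ξ t s =>
    eN_nonneg _ _ _ _ _ _ _ (y_pos hM hr s) (y_lt hM hr s)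
  have i0 : 0 ≤ I0 := intervalIntegral.integral_nonneg hNb (fun s _ => nn _ _ _)
  have i1 : 0 ≤ I1 := intervalIntegral.integral_nonneg hNb (fun s _ => nn _ _ _)
  have z0 : Z0 ≤ (352 + 40 * M) * I0 := hardy_int hM hr hχ hT hN hNb (hχv.at le_rfl hT)
  have z1 : Z1 ≤ (352 + 40 * M) * I1 := hardy_int hM hr hX hT hN hNb (hχv.svf.at le_rfl hT)
  have hD : ∫ s in (-N)..(b + T), nD M r (Svf φ) T s ≤ KB * ((I0 + Z0) + (I1 + Z1)) := by
    have c1 := hNχ T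
    have c2 := hNX T
    have c3 := nZ_cont hM hr hχ T
    have c4 := nZ_cont hM hr hX T
    have : ∫ s in (-N)..(b + T), nD M r (Svf φ) T s ≤ ∫ s in (-N)..(b + T),
        KB * ((nN M r χ T s + nZ M r χ T s) + (nN M r (Svf χ) T s + nZ M r (Svf χ) T s)) := by
      apply intervalIntegral.integral_mono_on hNb
      · exact (nD_cont hM hr hφs.svf T).intervalIntegrable _ _
      · exact (by fun_prop : Continuous _).intervalIntegrable _ _
      · intro s _; exact hB' φ hφs T s
    refine this.trans (le_of_eq ?_)
    rw [intervalIntegral.integral_const_mul,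
      intervalIntegral.integral_add ((by fun_prop : Continuous _).intervalIntegrable _ _)
        ((by fun_prop : Continuous _).intervalIntegrable _ _),
      intervalIntegral.integral_add (c1.intervalIntegrable _ _) (c3.intervalIntegrable _ _),
      intervalIntegral.integral_add (c2.intervalIntegrable _ _) (c4.intervalIntegrable _ _)]
  set P := ∫ s in (-N)..(b + T), (nP ε M r (Svf χ) T s + B * nP ε M r χ T s) with hPd
  have hPlow : 1 / 2 * I1 + B * (1 / 2 * I0) ≤ P := by
    have c1 := hNχ T
    have c2 := hNX T
    have c3 := hPχ T hT0
    have c4 := hPX T hT0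
    have e : 1 / 2 * I1 + B * (1 / 2 * I0) = ∫ s in (-N)..(b + T),
        (1 / 2 * nN M r (Svf χ) T s + B * (1 / 2 * nN M r χ T s)) := by
      rw [intervalIntegral.integral_add ((by fun_prop : Continuous _).intervalIntegrable _ _)
        ((by fun_prop : Continuous _).intervalIntegrable _ _),
        intervalIntegral.integral_const_mul, intervalIntegral.integral_const_mul,
        intervalIntegral.integral_const_mul]
    rw [e]
    apply intervalIntegral.integral_mono_on hNb
    · exact (by fun_prop : Continuous _).intervalIntegrable _ _
    · exact (by fun_prop : Continuous _).intervalIntegrable _ _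
    · intro s _
      have a1 := eP_ge (L := 2 * M) (y_pos hM hr s) (y_lt hM hr s) ε T s (Svf χ T s)
        (pd_t (Svf χ) T s) (pd_s (Svf χ) T s) hT0 hε0 hε1
      have a2 := eP_ge (L := 2 * M) (y_pos hM hr s) (y_lt hM hr s) ε T s (χ T s)
        (pd_t χ T s) (pd_s χ T s) hT0 hε0 hε1
      exact add_le_add a1 (mul_le_mul_of_nonneg_left a2 hB.le)
  -- upper bound
  have hab1 : -N - T + 1 ≤ b + 1 := by linarith
  set Q := ∫ s in (-N - T + 1)..(b + 1), (nP ε M r (Svf χ) 1 s + B * nP ε M r χ 1 s) with hQd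
  have hQ : Q ≤ 2 * (KA * (1 + B)) * (E0 M r φ + E0 M r (Svf φ)) := by
    have c1 := nD_cont hM hr hφs 1
    have c2 := nD_cont hM hr hφs.svf 1
    have c3 := hPχ 1 one_pos
    have c4 := hPX 1 one_pos
    have h1 : Q ≤ ∫ s in (-N - T + 1)..(b + 1),
        2 * (KA * (1 + B)) * (nD M r φ 1 s + nD M r (Svf φ) 1 s) := by
      apply intervalIntegral.integral_mono_on hab1
      · exact (by fun_prop : Continuous _).intervalIntegrable _ _
      · exact (by fun_prop : Continuous _).intervalIntegrable _ _
      · intro s _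
        have a1 := eP_le (L := 2 * M) (y_pos hM hr s) (y_lt hM hr s) ε 1 s (Svf χ 1 s)
          (pd_t (Svf χ) 1 s) (pd_s (Svf χ) 1 s) one_pos hε0 hε1
        have a2 := eP_le (L := 2 * M) (y_pos hM hr s) (y_lt hM hr s) ε 1 s (χ 1 s)
          (pd_t χ 1 s) (pd_s χ 1 s) one_pos hε0 hε1
        obtain ⟨b1, b2⟩ := hA φ hφs 1 s
        change nP ε M r (Svf χ) 1 s ≤ 2 * nN M r (Svf χ) 1 s at a1
        change nP ε M r χ 1 s ≤ 2 * nN M r χ 1 s at a2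
        change nN M r χ 1 s ≤ KA * nD M r φ 1 s at b1
        change nN M r (Svf χ) 1 s ≤ KA * (nD M r φ 1 s + nD M r (Svf φ) 1 s) at b2
        have d2 := nD_nonneg hM hr (Svf φ) 1 s
        have f1 : B * nP ε M r χ 1 s ≤ B * (2 * (KA * nD M r φ 1 s)) :=
          mul_le_mul_of_nonneg_left (by linarith) hB.le
        have f2 : 0 ≤ B * KA * nD M r (Svf φ) 1 s := by positivity
        nlinarith
    rw [intervalIntegral.integral_const_mul, intervalIntegral.integral_add
      (c1.intervalIntegrable _ _) (c2.intervalIntegrable _ _)] at h1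
    refine h1.trans ?_
    apply mul_le_mul_of_nonneg_left _ (by positivity)
    exact add_le_add (nD_int_le hM hr hφs hf.2.1 hab1) (nD_int_le hM hr hφs.svf hf.1 hab1)
  have hE : E0 M r φ + E0 M r (Svf φ) ≤ E1 M r φ := by
    unfold E1
    have : 0 ≤ E0 M r (pd_t φ) := integral_nonneg (E0I_nonneg hM hr _)
    linarith
  have hE1 : 0 ≤ E1 M r φ := by
    have g1 : 0 ≤ E0 M r φ := integral_nonneg (E0I_nonneg hM hr _)
    have g2 : 0 ≤ E0 M r (Svf φ) := integral_nonneg (E0I_nonneg hM hr _)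
    linarith
  have hρ := rho_pos δ C0 T hT0
  have hP : P ≤ T ^ δ * (rho δ C0 1 * Q) := by
    have h1 : P ≤ (rho δ C0 T)⁻¹ * (rho δ C0 1 * Q) := by
      rw [← div_eq_inv_mul, le_div_iff₀ hρ]; linarith
    have hQ0 : 0 ≤ rho δ C0 1 * Q := by
      have : 0 ≤ rho δ C0 T * P := by
        apply mul_nonneg hρ.le
        refine le_trans ?_ hPlow
        positivity
      exact this.trans hm'
    exact h1.trans (mul_le_mul_of_nonneg_right (rho_inv δ C0 T hC0 hT0) hQ0)
  have hI : I0 + I1 ≤ 2 * (1 + 1 / B) * P := by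
    have e : 2 * (1 + 1 / B) * (1 / 2 * I1 + B * (1 / 2 * I0)) = I1 + I0 + (B * I0 + I1 / B) := by
      field_simp; ring
    have g : 0 ≤ B * I0 + I1 / B := by positivity
    have := mul_le_mul_of_nonneg_left hPlow (by positivity : 0 ≤ 2 * (1 + 1 / B))
    linarith
  have hTδ := rpow_pos_of_pos hT0 δ
  calc ∫ s in (-N)..(b + T), nD M r (Svf φ) T s ≤ KB * ((I0 + Z0) + (I1 + Z1)) := hD
    _ ≤ KB * ((353 + 40 * M) * (I0 + I1)) := by
        apply mul_le_mul_of_nonneg_left _ hKB.le; linarith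
    _ ≤ KB * ((353 + 40 * M) * (2 * (1 + 1 / B) * (T ^ δ * (rho δ C0 1 *
          (2 * (KA * (1 + B)) * E1 M r φ))))) := by
        gcongr
        refine hI.trans ?_
        gcongr
        refine hP.trans ?_
        gcongr
        refine hQ.trans ?_
        gcongr
    _ = _ := by ring

theorem final (hM : 0 < M) (hr : IsTortoise M r) (δ : ℝ) (hδ : 0 < δ) (hδ1 : δ < 1) :
    ∃ C : ℝ, 0 < C ∧ ∀ φ : ℝ → ℝ → ℝ, IsWaveSol r φ → FinE1 M r φ →
      ∀ T, 1 ≤ T → ∫ s, nD M r (Svf φ) T s ≤ C * T ^ δ * E1 M r φ := by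
  obtain ⟨C, hC, hc⟩ := trunc hM hr δ hδ hδ1
  refine ⟨C, hC, ?_⟩
  intro φ hφ hf T hT
  obtain ⟨b, hb⟩ := hφ.2.2
  have hv : Van b φ := fun t s h => hb t s h.le
  have ht := hc φ hφ hf b hv T hT
  have hT0 : 0 < T := by linarith
  have hsup : ∀ s, s ∉ Set.Iic (b + T) → nD M r (Svf φ) T s = 0 := by
    intro s hs
    simp only [Set.mem_Iic, not_le] at hs
    unfold nD dn
    rw [hv.svf.at hs.le hT, hv.svf.pdt.at hs.le hT, hv.svf.pds.at hs.le hT]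
    simp
  by_cases hi : Integrable (nD M r (Svf φ) T)
  · rw [← setIntegral_eq_integral_of_forall_compl_eq_zero hsup]
    have hl := intervalIntegral_tendsto_integral_Iic (b + T) hi.integrableOn
      (Filter.tendsto_neg_atTop_atBot (G := ℝ))
    refine le_of_tendsto hl ?_
    filter_upwards [Filter.eventually_ge_atTop T, Filter.eventually_ge_atTop (-(b + T))] with N h1 h2
    exact ht N h1 (by linarith)
  · rw [integral_undef hi]
    have hTδ := rpow_pos_of_pos hT0 δ
    have g0 : 0 ≤ E0 M r φ := integral_nonneg (E0I_nonneg hM hr _)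
    have g1 : 0 ≤ E0 M r (Svf φ) := integral_nonneg (E0I_nonneg hM hr _)
    have g2 : 0 ≤ E0 M r (pd_t φ) := integral_nonneg (E0I_nonneg hM hr _)
    unfold E1
    positivity

end W

/-- Theorem 10, part 2 (spherically symmetric case): the conformal energy of
`ψ = Sφ` grows at most like `t^δ`. -/
theorem conformal_energy_of_Sphi_grows_slowly
    (M : ℝ) (hM : 0 < M) (r : ℝ → ℝ) (hr : IsTortoise M r)
    (δ : ℝ) (hδ0 : 0 < δ) (hδ1 : δ < 1) :
    ∃ C : ℝ, 0 < C ∧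
      ∀ φ : ℝ → ℝ → ℝ, IsWaveSol r φ → FinE1 M r φ →
        ∀ tstar : ℝ, 1 ≤ tstar →
          (∫ s, (((tstar - s) / 2) ^ 2
                * (pd_t (Svf φ) tstar s - pd_s (Svf φ) tstar s) ^ 2
              + ((tstar + s) / 2) ^ 2
                * (pd_t (Svf φ) tstar s + pd_s (Svf φ) tstar s) ^ 2
              + (1 - muS M r s) * ((tstar ^ 2 + s ^ 2) / (r s) ^ 2)
                * (Svf φ tstar s) ^ 2) * (r s) ^ 2)
            ≤ C * tstar ^ δ * E1 M r φ := by
  obtain ⟨C, hC, hc⟩ := final hM hr δ hδ0 hδ1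
  refine ⟨C, hC, ?_⟩
  intro φ hφ hf T hT
  refine le_trans (le_of_eq ?_) (hc φ hφ hf T hT)
  apply integral_congr_ae
  refine Filter.Eventually.of_forall (fun s => ?_)
  simp only [nD, dn, muS]
  rw [← y_sq hM hr s]
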